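/- Let 2/3 < γ < 2 and let x be a Bianchi VII₀ solution of the Wainwright–Hsu system with N₁ = 0 and N₂, N₃ > 0, which is not of Taub type and which does not converge, as τ → −∞, to the fixed point F nor to either of the fixed points P₂⁺(II), P₃⁺(II). Then x converges as τ → −∞ to a point on the Kasner circle lying in K₁ (in particular Ω, N₂, N₃ → 0 and Σ₊ converges to a value greater than 1/2). -/

import Mathlib

open Real Filter Topology Set

noncomputable section

namespace WainwrightHsu

/-- The deceleration parameter `q` of the Wainwright–Hsu system. -/
def qf (γ O Sp Sm : ℝ) : ℝ := (1/2) * (3*γ - 2) * O + 2 * (Sp^2 + Sm^2)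

/-- The curvature term `S₊`. -/
def SPf (n1 n2 n3 : ℝ) : ℝ := (1/2) * ((n2 - n3)^2 - n1 * (2*n1 - n2 - n3))

/-- The curvature term `S₋`. -/
def SMf (n1 n2 n3 : ℝ) : ℝ := (Real.sqrt 3 / 2) * (n3 - n2) * (n1 - n2 - n3)

/-- The Hamiltonian constraint. -/
def Constraint (O Sp Sm n1 n2 n3 : ℝ) : Prop :=
  O + Sp^2 + Sm^2 + (3/4) * (n1^2 + n2^2 + n3^2 - 2*(n1*n2 + n2*n3 + n3*n1)) = 1

/-- `(O, Sp, Sm, n1, n2, n3)` is a solution of the Wainwright–Hsu system (with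
parameter `γ`) on the set `s ⊆ ℝ`, satisfying `Ω ≥ 0` and the constraint. -/
structure SolOn (γ : ℝ) (s : Set ℝ) (O Sp Sm n1 n2 n3 : ℝ → ℝ) : Prop where
  hn1 : ∀ τ ∈ s, HasDerivAt n1 ((qf γ (O τ) (Sp τ) (Sm τ) - 4 * Sp τ) * n1 τ) τ
  hn2 : ∀ τ ∈ s, HasDerivAt n2
    ((qf γ (O τ) (Sp τ) (Sm τ) + 2 * Sp τ + 2 * Real.sqrt 3 * Sm τ) * n2 τ) τ
  hn3 : ∀ τ ∈ s, HasDerivAt n3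
    ((qf γ (O τ) (Sp τ) (Sm τ) + 2 * Sp τ - 2 * Real.sqrt 3 * Sm τ) * n3 τ) τ
  hSp : ∀ τ ∈ s, HasDerivAt Sp
    (-(2 - qf γ (O τ) (Sp τ) (Sm τ)) * Sp τ - 3 * SPf (n1 τ) (n2 τ) (n3 τ)) τ
  hSm : ∀ τ ∈ s, HasDerivAt Sm
    (-(2 - qf γ (O τ) (Sp τ) (Sm τ)) * Sm τ - 3 * SMf (n1 τ) (n2 τ) (n3 τ)) τ
  hO : ∀ τ ∈ s, HasDerivAt O ((2 * qf γ (O τ) (Sp τ) (Sm τ) - (3*γ - 2)) * O τ) τ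
  hOnn : ∀ τ ∈ s, 0 ≤ O τ
  hcon : ∀ τ ∈ s, Constraint (O τ) (Sp τ) (Sm τ) (n1 τ) (n2 τ) (n3 τ)

/-- The solution is of Taub type. -/
def TaubType (s : Set ℝ) (Sp Sm n1 n2 n3 : ℝ → ℝ) : Prop :=
  (∀ τ ∈ s, Sm τ = 0 ∧ n2 τ = n3 τ) ∨
  (∀ τ ∈ s, Sm τ = -(Real.sqrt 3) * Sp τ ∧ n1 τ = n2 τ) ∨
  (∀ τ ∈ s, Sm τ = Real.sqrt 3 * Sp τ ∧ n3 τ = n1 τ)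

/-- The solution converges to the fixed point `F` as `τ → -∞`. -/
def TendstoF (O Sp Sm n1 n2 n3 : ℝ → ℝ) : Prop :=
  Tendsto O atBot (𝓝 1) ∧ Tendsto Sp atBot (𝓝 0) ∧ Tendsto Sm atBot (𝓝 0) ∧
  Tendsto n1 atBot (𝓝 0) ∧ Tendsto n2 atBot (𝓝 0) ∧ Tendsto n3 atBot (𝓝 0)

/-- The solution converges to the fixed point `P₁⁺(II)` as `τ → -∞`. -/
def TendstoP1 (γ : ℝ) (O Sp Sm n1 n2 n3 : ℝ → ℝ) : Prop :=
  Tendsto O atBot (𝓝 (1 - (3*γ - 2)/16)) ∧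
  Tendsto Sp atBot (𝓝 ((3*γ - 2)/8)) ∧ Tendsto Sm atBot (𝓝 0) ∧
  (∃ c : ℝ, 0 < c ∧ Tendsto n1 atBot (𝓝 c)) ∧
  Tendsto n2 atBot (𝓝 0) ∧ Tendsto n3 atBot (𝓝 0)

/-- The solution converges to the fixed point `P₂⁺(II)` as `τ → -∞`. -/
def TendstoP2 (γ : ℝ) (O Sp Sm n1 n2 n3 : ℝ → ℝ) : Prop :=
  Tendsto O atBot (𝓝 (1 - (3*γ - 2)/16)) ∧
  Tendsto Sp atBot (𝓝 (-((3*γ - 2)/16))) ∧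
  Tendsto Sm atBot (𝓝 (-(Real.sqrt 3 * (3*γ - 2)/16))) ∧
  Tendsto n1 atBot (𝓝 0) ∧
  (∃ c : ℝ, 0 < c ∧ Tendsto n2 atBot (𝓝 c)) ∧ Tendsto n3 atBot (𝓝 0)

/-- The solution converges to the fixed point `P₃⁺(II)` as `τ → -∞`. -/
def TendstoP3 (γ : ℝ) (O Sp Sm n1 n2 n3 : ℝ → ℝ) : Prop :=
  Tendsto O atBot (𝓝 (1 - (3*γ - 2)/16)) ∧
  Tendsto Sp atBot (𝓝 (-((3*γ - 2)/16))) ∧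
  Tendsto Sm atBot (𝓝 (Real.sqrt 3 * (3*γ - 2)/16)) ∧
  Tendsto n1 atBot (𝓝 0) ∧ Tendsto n2 atBot (𝓝 0) ∧
  (∃ c : ℝ, 0 < c ∧ Tendsto n3 atBot (𝓝 c))

/-- A Bianchi IX solution is generic if it is not of Taub type and does not
converge to `F` nor to any of the `Pᵢ⁺(II)` as `τ → -∞`. -/
def Generic (γ : ℝ) (s : Set ℝ) (O Sp Sm n1 n2 n3 : ℝ → ℝ) : Prop :=
  ¬ TaubType s Sp Sm n1 n2 n3 ∧ ¬ TendstoF O Sp Sm n1 n2 n3 ∧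
  ¬ TendstoP1 γ O Sp Sm n1 n2 n3 ∧ ¬ TendstoP2 γ O Sp Sm n1 n2 n3 ∧
  ¬ TendstoP3 γ O Sp Sm n1 n2 n3

/-- `(a, b, c, d, e, f)` is an α-limit point of the solution:
some sequence of times tending to `-∞` along which the solution converges to it. -/
def AlphaLim (O Sp Sm n1 n2 n3 : ℝ → ℝ) (a b c d e f : ℝ) : Prop :=
  ∃ τs : ℕ → ℝ, Tendsto τs atTop atBot ∧
    Tendsto (fun k => O (τs k)) atTop (𝓝 a) ∧
    Tendsto (fun k => Sp (τs k)) atTop (𝓝 b) ∧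
    Tendsto (fun k => Sm (τs k)) atTop (𝓝 c) ∧
    Tendsto (fun k => n1 (τs k)) atTop (𝓝 d) ∧
    Tendsto (fun k => n2 (τs k)) atTop (𝓝 e) ∧
    Tendsto (fun k => n3 (τs k)) atTop (𝓝 f)

/-- ω-limit point (times tending to `+∞`). -/
def OmegaLim (O Sp Sm n1 n2 n3 : ℝ → ℝ) (a b c d e f : ℝ) : Prop :=
  ∃ τs : ℕ → ℝ, Tendsto τs atTop atTop ∧
    Tendsto (fun k => O (τs k)) atTop (𝓝 a) ∧
    Tendsto (fun k => Sp (τs k)) atTop (𝓝 b) ∧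
    Tendsto (fun k => Sm (τs k)) atTop (𝓝 c) ∧
    Tendsto (fun k => n1 (τs k)) atTop (𝓝 d) ∧
    Tendsto (fun k => n2 (τs k)) atTop (𝓝 e) ∧
    Tendsto (fun k => n3 (τs k)) atTop (𝓝 f)

/-- α-limit point, phrased for a point of `ℝ⁶` (in coordinates `Ω, Σ₊, Σ₋, N₁, N₂, N₃`). -/
def AlphaLimPt (O Sp Sm n1 n2 n3 : ℝ → ℝ) (p : Fin 6 → ℝ) : Prop :=
  ∃ τs : ℕ → ℝ, Tendsto τs atTop atBot ∧
    Tendsto (fun k =>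
      (![O (τs k), Sp (τs k), Sm (τs k), n1 (τs k), n2 (τs k), n3 (τs k)] : Fin 6 → ℝ))
      atTop (𝓝 p)

/-- A non-special point of the Kasner circle, given by its `(Σ₊, Σ₋)` coordinates. -/
def NonSpecialKasner (a b : ℝ) : Prop :=
  a^2 + b^2 = 1 ∧ (a, b) ≠ (-1, 0) ∧
  (a, b) ≠ (1/2, Real.sqrt 3 / 2) ∧ (a, b) ≠ (1/2, -(Real.sqrt 3) / 2)

/-- The state vector of a solution, as a point of Euclidean `ℝ⁶`. -/
def stateVec (O Sp Sm n1 n2 n3 : ℝ → ℝ) (τ : ℝ) : EuclideanSpace ℝ (Fin 6) :=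
  (WithLp.equiv 2 (Fin 6 → ℝ)).symm ![O τ, Sp τ, Sm τ, n1 τ, n2 τ, n3 τ]

/-- The Bianchi attractor `𝒜`: the closure of the vacuum type I and II points, i.e. the
points of `ℝ⁶` satisfying the constraint with `Ω = 0` and `N₁N₂ = N₂N₃ = N₃N₁ = 0`. -/
def attractor : Set (EuclideanSpace ℝ (Fin 6)) :=
  {y | Constraint (y 0) (y 1) (y 2) (y 3) (y 4) (y 5) ∧
    y 0 = 0 ∧ y 3 * y 4 = 0 ∧ y 4 * y 5 = 0 ∧ y 5 * y 3 = 0}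


/-! ## General calculus lemmas on half-lines -/

lemma anti_of_deriv {f f' : ℝ → ℝ} {T : ℝ} (h : ∀ τ ≤ T, HasDerivAt f (f' τ) τ)
    (hn : ∀ τ ≤ T, f' τ ≤ 0) : AntitoneOn f (Iic T) := by
  apply antitoneOn_of_deriv_nonpos (convex_Iic T)
  · intro x hx; exact (h x hx).continuousAt.continuousWithinAt
  · intro x hx
    exact (h x (mem_Iic.1 (interior_subset hx))).differentiableAt.differentiableWithinAt
  · intro x hx
    have hx' : x ≤ T := mem_Iic.1 (interior_subset hx)
    rw [(h x hx').deriv]; exact hn x hx'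

lemma mono_of_deriv {f f' : ℝ → ℝ} {T : ℝ} (h : ∀ τ ≤ T, HasDerivAt f (f' τ) τ)
    (hn : ∀ τ ≤ T, 0 ≤ f' τ) : MonotoneOn f (Iic T) := by
  apply monotoneOn_of_deriv_nonneg (convex_Iic T)
  · intro x hx; exact (h x hx).continuousAt.continuousWithinAt
  · intro x hx
    exact (h x (mem_Iic.1 (interior_subset hx))).differentiableAt.differentiableWithinAt
  · intro x hx
    have hx' : x ≤ T := mem_Iic.1 (interior_subset hx)
    rw [(h x hx').deriv]; exact hn x hx'

lemma anti_le_lim {f : ℝ → ℝ} {T l : ℝ} (h : AntitoneOn f (Iic T))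
    (hl : Tendsto f atBot (𝓝 l)) : ∀ τ ≤ T, f τ ≤ l := by
  intro τ hτ
  apply ge_of_tendsto hl
  filter_upwards [eventually_le_atBot τ] with s hs
  exact h (hs.trans hτ) hτ hs

lemma mono_ge_lim {f : ℝ → ℝ} {T l : ℝ} (h : MonotoneOn f (Iic T))
    (hl : Tendsto f atBot (𝓝 l)) : ∀ τ ≤ T, l ≤ f τ := by
  intro τ hτ
  apply le_of_tendsto hl
  filter_upwards [eventually_le_atBot τ] with s hs
  exact h (hs.trans hτ) hτ hs

lemma anti_dichotomy {f : ℝ → ℝ} {T : ℝ} (h : AntitoneOn f (Iic T)) :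
    Tendsto f atBot atTop ∨ ∃ l, Tendsto f atBot (𝓝 l) := by
  have hm : Monotone (fun s => f (min (-s) T)) := by
    intro s t hst
    exact h (mem_Iic.2 (min_le_right _ _)) (mem_Iic.2 (min_le_right _ _))
      (min_le_min_right _ (by linarith))
  have heq : (fun s => f (min (-s) T)) ∘ (fun τ : ℝ => -τ) =ᶠ[atBot] f := by
    filter_upwards [eventually_le_atBot T] with s hs
    simp [min_eq_left hs]
  rcases tendsto_atTop_of_monotone hm with h1 | ⟨l, h1⟩
  · left; exact (h1.comp tendsto_neg_atBot_atTop).congr' heq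
  · right; exact ⟨l, (h1.comp tendsto_neg_atBot_atTop).congr' heq⟩

lemma anti_conv {f : ℝ → ℝ} {T M : ℝ} (h : AntitoneOn f (Iic T)) (hM : ∀ τ ≤ T, f τ ≤ M) :
    ∃ l, Tendsto f atBot (𝓝 l) := by
  rcases anti_dichotomy h with h1 | h1
  · exfalso
    obtain ⟨τ, h2, h3⟩ := ((h1.eventually (eventually_gt_atTop M)).and
      (eventually_le_atBot T)).exists
    linarith [hM τ h3]
  · exact h1

lemma mono_conv {f : ℝ → ℝ} {T M : ℝ} (h : MonotoneOn f (Iic T)) (hM : ∀ τ ≤ T, M ≤ f τ) :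
    ∃ l, Tendsto f atBot (𝓝 l) := by
  obtain ⟨l, hl⟩ := anti_conv (f := fun τ => - f τ) (T := T) (M := -M)
    (fun x hx y hy hxy => neg_le_neg (h hx hy hxy)) (fun τ hτ => neg_le_neg (hM τ hτ))
  exact ⟨-l, by simpa using hl.neg⟩

/-- bounded with bounded derivative on `(-∞, 0]` -/
def LB (f : ℝ → ℝ) : Prop :=
  ∃ M, ∀ τ ≤ (0:ℝ), |f τ| ≤ M ∧ ∃ d, HasDerivAt f d τ ∧ |d| ≤ M

lemma LB.const (k : ℝ) : LB (fun _ => k) :=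
  ⟨|k|, fun τ _ => ⟨le_rfl, 0, hasDerivAt_const τ k, by simp⟩⟩

lemma LB.add {f g : ℝ → ℝ} (hf : LB f) (hg : LB g) : LB (fun τ => f τ + g τ) := by
  obtain ⟨M, hM⟩ := hf
  obtain ⟨N, hN⟩ := hg
  refine ⟨M + N, fun τ hτ => ?_⟩
  obtain ⟨h1, d, h2, h3⟩ := hM τ hτ
  obtain ⟨h4, e, h5, h6⟩ := hN τ hτ
  exact ⟨(abs_add_le _ _).trans (add_le_add h1 h4), d + e, h2.add h5,
    (abs_add_le _ _).trans (add_le_add h3 h6)⟩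

lemma LB.mul {f g : ℝ → ℝ} (hf : LB f) (hg : LB g) : LB (fun τ => f τ * g τ) := by
  obtain ⟨M, hM⟩ := hf
  obtain ⟨N, hN⟩ := hg
  refine ⟨2 * (M * N), fun τ hτ => ?_⟩
  obtain ⟨h1, d, h2, h3⟩ := hM τ hτ
  obtain ⟨h4, e, h5, h6⟩ := hN τ hτ
  have hM0 : 0 ≤ M := (abs_nonneg _).trans h1
  have hN0 : 0 ≤ N := (abs_nonneg _).trans h4
  have := mul_nonneg hM0 hN0
  refine ⟨?_, d * g τ + f τ * e, h2.mul h5, ?_⟩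
  · rw [abs_mul]
    nlinarith [mul_le_mul h1 h4 (abs_nonneg _) hM0]
  · refine (abs_add_le _ _).trans ?_
    rw [abs_mul, abs_mul]
    nlinarith [mul_le_mul h3 h4 (abs_nonneg _) hM0, mul_le_mul h1 h6 (abs_nonneg _) hM0]

lemma LB.neg {f : ℝ → ℝ} (hf : LB f) : LB (fun τ => - f τ) := by
  simpa using (LB.const (-1)).mul hf

lemma LB.sub {f g : ℝ → ℝ} (hf : LB f) (hg : LB g) : LB (fun τ => f τ - g τ) := by
  simpa [sub_eq_add_neg] using hf.add hg.neg

lemma LB.sq {f : ℝ → ℝ} (hf : LB f) : LB (fun τ => f τ ^ 2) := by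
  simpa [_root_.pow_two] using hf.mul hf

lemma LB.inv {f : ℝ → ℝ} (hf : LB f) {δ : ℝ} (hδ : 0 < δ) (h : ∀ τ ≤ 0, δ ≤ f τ) :
    LB (fun τ => (f τ)⁻¹) := by
  obtain ⟨M, hM⟩ := hf
  refine ⟨max δ⁻¹ (M / δ ^ 2), fun τ hτ => ?_⟩
  obtain ⟨h1, d, h2, h3⟩ := hM τ hτ
  have hpos := hδ.trans_le (h τ hτ)
  refine ⟨?_, -d / f τ ^ 2, h2.inv hpos.ne', ?_⟩
  · rw [abs_of_pos (inv_pos.2 hpos)]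
    exact (inv_anti₀ hδ (h τ hτ)).trans (le_max_left _ _)
  · refine le_trans ?_ (le_max_right _ _)
    rw [abs_div, abs_neg, abs_of_pos (pow_pos hpos 2)]
    have := h τ hτ
    gcongr
    exact (abs_nonneg _).trans h3

/-- Barbalat type lemma. -/
lemma barbalat {F F' f : ℝ → ℝ} {l : ℝ} (hF : ∀ τ ≤ 0, HasDerivAt F (F' τ) τ)
    (hle : ∀ τ ≤ 0, |f τ| ≤ |F' τ|) (hf : LB f) (hl : Tendsto F atBot (𝓝 l)) :
    Tendsto f atBot (𝓝 0) := by
  obtain ⟨M, hM⟩ := hf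
  have hM0 : 0 ≤ M := (abs_nonneg _).trans (hM 0 le_rfl).1
  rw [Metric.tendsto_nhds]
  intro ε hε
  set h : ℝ := ε / (2 * (M + 1)) with hh
  have hpos : 0 < h := by positivity
  have hMh : M * h ≤ ε / 2 := by
    rw [hh]
    rw [mul_div_assoc', div_le_div_iff₀ (by positivity) (by positivity)]
    nlinarith
  have hball : ∀ᶠ τ in atBot, |F τ - l| < h * ε / 4 := by
    have := Metric.tendsto_nhds.1 hl (h * ε / 4) (by positivity)
    simpa [Real.dist_eq] using this
  obtain ⟨T, hT⟩ := eventually_atBot.1 hball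
  filter_upwards [eventually_le_atBot (min T 0 - h)] with τ hτ
  have hτT : τ + h ≤ T := by linarith [min_le_left T 0]
  have hτ0 : τ + h ≤ 0 := by linarith [min_le_right T 0]
  have hlt : τ < τ + h := by linarith
  obtain ⟨ξ, hξ, hξ2⟩ := exists_hasDerivAt_eq_slope F F' hlt
    (fun x hx => (hF x (hx.2.trans hτ0)).continuousAt.continuousWithinAt)
    (fun x hx => hF x (hx.2.le.trans hτ0))
  have h1 : |F' ξ| * h = |F (τ + h) - F τ| := by
    rw [hξ2, abs_div]
    rw [show τ + h - τ = h by ring, abs_of_pos hpos]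
    field_simp
  have h2 : |F (τ + h) - F τ| < h * ε / 2 := by
    have e1 := hT (τ + h) hτT
    have e2 := hT τ (by linarith)
    rw [abs_lt] at *
    constructor <;> linarith
  have h3 : |F' ξ| < ε / 2 := by
    by_contra hc
    push Not at hc
    nlinarith
  have h4 := hle ξ (hξ.2.le.trans hτ0)
  have h5 : |f ξ - f τ| ≤ M * h := by
    obtain ⟨η, hη, hη2⟩ := exists_deriv_eq_slope f hξ.1
      (fun x hx => by
        obtain ⟨_, d, hd, _⟩ := hM x (hx.2.trans (hξ.2.le.trans hτ0))
        exact hd.continuousAt.continuousWithinAt)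
      (fun x hx => by
        obtain ⟨_, d, hd, _⟩ := hM x (hx.2.le.trans (hξ.2.le.trans hτ0))
        exact hd.differentiableAt.differentiableWithinAt)
    obtain ⟨_, d, hd, hd2⟩ := hM η (hη.2.le.trans (hξ.2.le.trans hτ0))
    have e1 : f ξ - f τ = d * (ξ - τ) := by
      rw [← hd.deriv, hη2]
      have : ξ - τ ≠ 0 := by linarith [hξ.1]
      field_simp
    rw [e1, abs_mul, abs_of_pos (by linarith [hξ.1] : 0 < ξ - τ)]
    have : ξ - τ ≤ h := by linarith [hξ.2]
    have := hξ.1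
    gcongr
  rw [Real.dist_eq, sub_zero]
  have h6 : |f τ| ≤ |f ξ| + |f ξ - f τ| := by
    have := abs_sub_abs_le_abs_sub (f τ) (f ξ)
    rw [abs_sub_comm] at this
    linarith
  linarith


/-! ## The reduced system (type VII₀, constraint used to eliminate `q`) -/

/-- The reduced type VII₀ system; here `c = 3 (2 - γ) / 2` and `2 - q = 3/2 (a-b)² + c Ω`. -/
structure Sys (c : ℝ) (O S T a b : ℝ → ℝ) : Prop where
  c0 : 0 < c
  c2 : c < 2
  ha : ∀ τ, 0 < a τ
  hb : ∀ τ, 0 < b τ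
  hO : ∀ τ, 0 ≤ O τ
  con : ∀ τ, O τ + S τ ^ 2 + T τ ^ 2 + 3/4 * (a τ - b τ) ^ 2 = 1
  da : ∀ τ, HasDerivAt a
    ((2 - (3/2 * (a τ - b τ) ^ 2 + c * O τ) + 2 * S τ + 2 * √3 * T τ) * a τ) τ
  db : ∀ τ, HasDerivAt b
    ((2 - (3/2 * (a τ - b τ) ^ 2 + c * O τ) + 2 * S τ - 2 * √3 * T τ) * b τ) τ
  dS : ∀ τ, HasDerivAt S
    (-(3/2 * (a τ - b τ) ^ 2 + c * O τ) * S τ - 3/2 * (a τ - b τ) ^ 2) τ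
  dT : ∀ τ, HasDerivAt T
    (-(3/2 * (a τ - b τ) ^ 2 + c * O τ) * T τ - 3/2 * √3 * (a τ ^ 2 - b τ ^ 2)) τ
  dO : ∀ τ, HasDerivAt O
    ((2 * c - 2 * (3/2 * (a τ - b τ) ^ 2 + c * O τ)) * O τ) τ
  hy : ∀ τ, 0 < 4/3 * T τ ^ 2 + (a τ - b τ) ^ 2

namespace Sys

variable {c : ℝ} {O S T a b : ℝ → ℝ}

lemma s3 : √3 * √3 = (3:ℝ) := Real.mul_self_sqrt (by norm_num)

lemma swap (H : Sys c O S T a b) : Sys c O S (fun τ => - T τ) b a where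
  c0 := H.c0
  c2 := H.c2
  ha := H.hb
  hb := H.ha
  hO := H.hO
  con τ := by have := H.con τ; linear_combination this
  da τ := by convert H.db τ using 1; ring
  db τ := by convert H.da τ using 1; ring
  dS τ := by convert H.dS τ using 1; ring
  dT τ := by refine (H.dT τ).neg.congr_deriv ?_; ring
  dO τ := by convert H.dO τ using 1; ring
  hy τ := by have := H.hy τ; nlinarith

lemma O_le (H : Sys c O S T a b) (τ : ℝ) : O τ ≤ 1 := by
  nlinarith [H.con τ, sq_nonneg (S τ), sq_nonneg (T τ), sq_nonneg (a τ - b τ)]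

lemma K_le (H : Sys c O S T a b) (τ : ℝ) : (a τ - b τ) ^ 2 ≤ 4/3 := by
  nlinarith [H.con τ, sq_nonneg (S τ), sq_nonneg (T τ), sq_nonneg (a τ - b τ), H.hO τ]

lemma S_gt (H : Sys c O S T a b) (τ : ℝ) : -1 < S τ := by
  nlinarith [H.con τ, H.hy τ, H.hO τ]

lemma S_lt (H : Sys c O S T a b) (τ : ℝ) : S τ < 1 := by
  nlinarith [H.con τ, H.hy τ, H.hO τ]

lemma S_abs (H : Sys c O S T a b) (τ : ℝ) : |S τ| ≤ 1 :=
  abs_le.2 ⟨(H.S_gt τ).le, (H.S_lt τ).le⟩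

lemma T_abs (H : Sys c O S T a b) (τ : ℝ) : |T τ| ≤ 1 := by
  rw [abs_le]
  constructor <;>
  nlinarith [H.con τ, sq_nonneg (S τ), sq_nonneg (T τ), sq_nonneg (a τ - b τ), H.hO τ]

lemma dp (H : Sys c O S T a b) (τ : ℝ) : HasDerivAt (fun τ => a τ * b τ)
    ((4 - 2 * (3/2 * (a τ - b τ) ^ 2 + c * O τ) + 4 * S τ) * (a τ * b τ)) τ := by
  refine ((H.da τ).mul (H.db τ)).congr_deriv ?_; ring

lemma dy (H : Sys c O S T a b) (τ : ℝ) :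
    HasDerivAt (fun τ => 4/3 * T τ ^ 2 + (a τ - b τ) ^ 2)
    (-(8/3) * (3/2 * (a τ - b τ) ^ 2 + c * O τ) * T τ ^ 2
      + (4 - 2 * (3/2 * (a τ - b τ) ^ 2 + c * O τ) + 4 * S τ) * (a τ - b τ) ^ 2) τ := by
  refine ((((H.dT τ).pow 2).const_mul (4/3)).add (((H.da τ).sub (H.db τ)).pow 2)).congr_deriv ?_
  simp only [Pi.sub_apply, Nat.cast_ofNat, Nat.add_one_sub_one, pow_one]; ring

lemma dZ (H : Sys c O S T a b) (τ : ℝ) :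
    HasDerivAt (fun τ => (4/3 * T τ ^ 2 + (a τ - b τ) ^ 2) / (a τ * b τ))
    (-(16/3) * (T τ ^ 2 * (1 + S τ)) / (a τ * b τ)) τ := by
  have hp := mul_pos (H.ha τ) (H.hb τ)
  refine ((H.dy τ).div (H.dp τ) hp.ne').congr_deriv ?_
  have h1 := (H.ha τ).ne'
  have h2 := (H.hb τ).ne'
  field_simp
  ring

lemma y_le (H : Sys c O S T a b) (τ : ℝ) : 4/3 * T τ ^ 2 + (a τ - b τ) ^ 2 ≤ 4/3 := by
  nlinarith [H.con τ, sq_nonneg (S τ), H.hO τ]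

lemma Z_anti (H : Sys c O S T a b) :
    AntitoneOn (fun τ => (4/3 * T τ ^ 2 + (a τ - b τ) ^ 2) / (a τ * b τ)) (Iic 0) := by
  apply anti_of_deriv (fun τ _ => H.dZ τ)
  intro τ _
  have hp := mul_pos (H.ha τ) (H.hb τ)
  have hS := H.S_gt τ
  have : 0 ≤ T τ ^ 2 * (1 + S τ) := mul_nonneg (sq_nonneg _) (by linarith)
  apply div_nonpos_of_nonpos_of_nonneg _ hp.le
  linarith

/-- `ab ≤ C y` backwards in time -/
lemma p_le_y (H : Sys c O S T a b) : ∃ C > 0, ∀ τ ≤ 0,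
    a τ * b τ ≤ C * (4/3 * T τ ^ 2 + (a τ - b τ) ^ 2) := by
  have hp0 := mul_pos (H.ha 0) (H.hb 0)
  have hy0 := H.hy 0
  refine ⟨(a 0 * b 0) / (4/3 * T 0 ^ 2 + (a 0 - b 0) ^ 2), by positivity, fun τ hτ => ?_⟩
  have hp := mul_pos (H.ha τ) (H.hb τ)
  have := H.Z_anti hτ (mem_Iic.2 le_rfl) hτ
  simp only at this
  rw [div_le_div_iff₀ hp0 hp] at this
  rw [div_mul_eq_mul_div, le_div_iff₀ hy0]
  linarith

lemma ab_bdd (H : Sys c O S T a b) : ∃ M ≥ 1, ∀ τ ≤ 0, a τ ≤ M ∧ b τ ≤ M := by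
  obtain ⟨C, hC, h⟩ := H.p_le_y
  refine ⟨4/3 + 2 * (C * (4/3)) + 1, by nlinarith, fun τ hτ => ?_⟩
  have h1 := h τ hτ
  have h2 : a τ * b τ ≤ C * (4/3) := h1.trans (by gcongr; exact H.y_le τ)
  have h3 := H.K_le τ
  have ha := H.ha τ
  have hb := H.hb τ
  have h4 : a τ ^ 2 + b τ ^ 2 ≤ 4/3 + 2 * (C * (4/3)) := by nlinarith
  constructor <;> nlinarith [sq_nonneg (a τ - 1), sq_nonneg (b τ - 1), sq_nonneg (a τ),
    sq_nonneg (b τ)]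

end Sys

/-- Helper: bounded functions with a bounded derivative expression. -/
def Bd (f : ℝ → ℝ) : Prop := ∃ M, ∀ τ ≤ (0:ℝ), |f τ| ≤ M

lemma Bd.add {f g : ℝ → ℝ} (hf : Bd f) (hg : Bd g) : Bd (fun τ => f τ + g τ) := by
  obtain ⟨M, hM⟩ := hf
  obtain ⟨N, hN⟩ := hg
  exact ⟨M + N, fun τ hτ => (abs_add_le _ _).trans (add_le_add (hM τ hτ) (hN τ hτ))⟩

lemma Bd.mul {f g : ℝ → ℝ} (hf : Bd f) (hg : Bd g) : Bd (fun τ => f τ * g τ) := by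
  obtain ⟨M, hM⟩ := hf
  obtain ⟨N, hN⟩ := hg
  refine ⟨M * N, fun τ hτ => ?_⟩
  rw [abs_mul]
  exact mul_le_mul (hM τ hτ) (hN τ hτ) (abs_nonneg _) ((abs_nonneg _).trans (hM τ hτ))

lemma Bd.const (k : ℝ) : Bd (fun _ => k) := ⟨|k|, fun _ _ => le_rfl⟩

lemma Bd.neg {f : ℝ → ℝ} (hf : Bd f) : Bd (fun τ => - f τ) := by
  obtain ⟨M, hM⟩ := hf
  exact ⟨M, fun τ hτ => by rw [abs_neg]; exact hM τ hτ⟩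

lemma Bd.sub {f g : ℝ → ℝ} (hf : Bd f) (hg : Bd g) : Bd (fun τ => f τ - g τ) := by
  simpa [sub_eq_add_neg] using hf.add hg.neg

lemma Bd.sq {f : ℝ → ℝ} (hf : Bd f) : Bd (fun τ => f τ ^ 2) := by
  simpa [_root_.pow_two] using hf.mul hf

lemma LB.bd {f : ℝ → ℝ} (hf : LB f) : Bd f := by
  obtain ⟨M, hM⟩ := hf
  exact ⟨M, fun τ hτ => (hM τ hτ).1⟩

lemma LB.mk {f f' : ℝ → ℝ} (hf : Bd f) (hd : ∀ τ ≤ 0, HasDerivAt f (f' τ) τ) (hf' : Bd f') :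
    LB f := by
  obtain ⟨M, hM⟩ := hf
  obtain ⟨N, hN⟩ := hf'
  exact ⟨max M N, fun τ hτ => ⟨(hM τ hτ).trans (le_max_left _ _), f' τ, hd τ hτ,
    (hN τ hτ).trans (le_max_right _ _)⟩⟩

namespace Sys

variable {c : ℝ} {O S T a b : ℝ → ℝ}

lemma bdO (H : Sys c O S T a b) : Bd O :=
  ⟨1, fun τ _ => by rw [abs_of_nonneg (H.hO τ)]; exact H.O_le τ⟩
lemma bdS (H : Sys c O S T a b) : Bd S := ⟨1, fun τ _ => H.S_abs τ⟩
lemma bdT (H : Sys c O S T a b) : Bd T := ⟨1, fun τ _ => H.T_abs τ⟩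
lemma bda (H : Sys c O S T a b) : Bd a := by
  obtain ⟨M, _, h⟩ := H.ab_bdd
  exact ⟨M, fun τ hτ => by rw [abs_of_pos (H.ha τ)]; exact (h τ hτ).1⟩
lemma bdb (H : Sys c O S T a b) : Bd b := H.swap.bda

lemma bdw (H : Sys c O S T a b) : Bd (fun τ => 3/2 * (a τ - b τ) ^ 2 + c * O τ) :=
  ((Bd.const _).mul (H.bda.sub H.bdb).sq).add ((Bd.const _).mul H.bdO)

lemma lbO (H : Sys c O S T a b) : LB O :=
  LB.mk H.bdO (fun τ _ => H.dO τ)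
    (((Bd.const _).sub ((Bd.const _).mul H.bdw)).mul H.bdO)
lemma lba (H : Sys c O S T a b) : LB a :=
  LB.mk H.bda (fun τ _ => H.da τ)
    (((((Bd.const _).sub H.bdw).add ((Bd.const _).mul H.bdS)).add
      ((Bd.const _).mul H.bdT)).mul H.bda)
lemma lbb (H : Sys c O S T a b) : LB b := H.swap.lba
lemma lbS (H : Sys c O S T a b) : LB S :=
  LB.mk H.bdS (fun τ _ => H.dS τ)
    ((H.bdw.neg.mul H.bdS).sub ((Bd.const _).mul (H.bda.sub H.bdb).sq))
lemma lbT (H : Sys c O S T a b) : LB T :=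
  LB.mk H.bdT (fun τ _ => H.dT τ)
    ((H.bdw.neg.mul H.bdT).sub ((Bd.const _).mul (H.bda.sq.sub H.bdb.sq)))
lemma lbw (H : Sys c O S T a b) : LB (fun τ => 3/2 * (a τ - b τ) ^ 2 + c * O τ) :=
  ((LB.const _).mul (H.lba.sub H.lbb).sq).add ((LB.const _).mul H.lbO)

/-- derivative of a convergent quantity tends to zero -/
lemma _root_.WainwrightHsu.deriv_tendsto {F F' : ℝ → ℝ} {l : ℝ}
    (hF : ∀ τ ≤ 0, HasDerivAt F (F' τ) τ) (hf : LB F') (hl : Tendsto F atBot (𝓝 l)) :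
    Tendsto F' atBot (𝓝 0) := barbalat hF (fun _ _ => le_rfl) hf hl

lemma _root_.WainwrightHsu.tendsto_zero_of_sq {f : ℝ → ℝ}
    (h : Tendsto (fun τ => f τ ^ 2) atBot (𝓝 0)) : Tendsto f atBot (𝓝 0) := by
  have h1 := (Real.continuous_sqrt.tendsto 0).comp h
  simp only [Function.comp_def, Real.sqrt_sq_eq_abs, Real.sqrt_zero] at h1
  exact (tendsto_zero_iff_abs_tendsto_zero _).2 h1

lemma p_tendsto (H : Sys c O S T a b) : Tendsto (fun τ => a τ * b τ) atBot (𝓝 0) := by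
  obtain ⟨C, hC, hCy⟩ := H.p_le_y
  rcases anti_dichotomy H.Z_anti with h | ⟨l, hl⟩
  · -- Z → ∞
    have h1 := (tendsto_inv_atTop_zero.comp h).const_mul (4/3)
    rw [mul_zero] at h1
    refine squeeze_zero (fun τ => (mul_pos (H.ha τ) (H.hb τ)).le) (fun τ => ?_) h1
    simp only [Function.comp_def, inv_div]
    have hp := mul_pos (H.ha τ) (H.hb τ)
    rw [mul_div_assoc', le_div_iff₀ (H.hy τ)]
    nlinarith [H.y_le τ]
  · -- Z bounded
    have hq : Tendsto (fun τ => (16/3) / (C * (4/3)) * (T τ ^ 2 * (1 + S τ))) atBot (𝓝 0) := by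
      refine barbalat (fun τ _ => H.dZ τ) (fun τ hτ => ?_) ?_ hl
      · have hp := mul_pos (H.ha τ) (H.hb τ)
        have hS := H.S_gt τ
        have h0 : 0 ≤ T τ ^ 2 * (1 + S τ) := mul_nonneg (sq_nonneg _) (by linarith)
        rw [abs_of_nonneg (by positivity), neg_mul, neg_div, abs_neg,
          abs_of_nonneg (by positivity), div_mul_eq_mul_div]
        have h2 : a τ * b τ ≤ C * (4/3) := (hCy τ hτ).trans (by gcongr; exact H.y_le τ)
        gcongr
      · exact (LB.const _).mul (H.lbT.sq.mul ((LB.const _).add H.lbS))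
    have hq2 : Tendsto (fun τ => T τ ^ 2 * (1 + S τ)) atBot (𝓝 0) := by
      have := hq.const_mul (((16/3) / (C * (4/3)))⁻¹)
      simp only [mul_zero] at this
      refine this.congr (fun τ => ?_)
      field_simp
    have hT4 : Tendsto (fun τ => (T τ ^ 2) ^ 2) atBot (𝓝 0) := by
      have := hq2.const_mul 2
      rw [mul_zero] at this
      refine squeeze_zero (fun τ => by positivity) (fun τ => ?_) this
      have h1 : T τ ^ 2 ≤ 2 * (1 + S τ) := by
        nlinarith [H.con τ, H.hO τ, sq_nonneg (a τ - b τ), sq_nonneg (1 + S τ)]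
      nlinarith [sq_nonneg (T τ)]
    have hT2 := tendsto_zero_of_sq hT4
    have hT := tendsto_zero_of_sq hT2
    have hT' := deriv_tendsto (fun τ _ => H.dT τ)
      ((H.lbw.neg.mul H.lbT).sub ((LB.const _).mul (H.lba.sq.sub H.lbb.sq))) hT
    obtain ⟨M, hM⟩ := H.bdw
    have hwT : Tendsto (fun τ => (3/2 * (a τ - b τ) ^ 2 + c * O τ) * T τ) atBot (𝓝 0) := by
      rw [tendsto_zero_iff_abs_tendsto_zero] at hT ⊢
      have := hT.const_mul M
      rw [mul_zero] at this
      refine squeeze_zero' (Eventually.of_forall fun τ => abs_nonneg _) ?_ this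
      filter_upwards [eventually_le_atBot 0] with τ hτ
      simp only [Function.comp_def]
      rw [abs_mul]
      have := hM τ hτ
      gcongr
    have hd : Tendsto (fun τ => a τ ^ 2 - b τ ^ 2) atBot (𝓝 0) := by
      have := (hT'.add hwT).const_mul (-(3/2 * √3)⁻¹)
      simp only [add_zero, mul_zero] at this
      refine this.congr (fun τ => ?_)
      have : √3 ≠ (0:ℝ) := by positivity
      field_simp
      ring
    have hK : Tendsto (fun τ => (a τ - b τ) ^ 2) atBot (𝓝 0) := by
      rw [tendsto_zero_iff_abs_tendsto_zero] at hd
      refine squeeze_zero (fun τ => by positivity) (fun τ => ?_) hd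
      simp only [Function.comp_def]
      rw [show a τ ^ 2 - b τ ^ 2 = (a τ - b τ) * (a τ + b τ) by ring, abs_mul,
        ← sq_abs, _root_.pow_two]
      have ha := H.ha τ
      have hb := H.hb τ
      refine mul_le_mul_of_nonneg_left ?_ (abs_nonneg _)
      rw [abs_le, abs_of_pos (by linarith : 0 < a τ + b τ)]
      constructor <;> linarith
    have hy : Tendsto (fun τ => C * (4/3 * T τ ^ 2 + (a τ - b τ) ^ 2)) atBot (𝓝 0) := by
      have := ((hT2.const_mul (4/3)).add hK).const_mul C
      simpa using this
    refine squeeze_zero' (Eventually.of_forall fun τ => (mul_pos (H.ha τ) (H.hb τ)).le) ?_ hy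
    filter_upwards [eventually_le_atBot 0] with τ hτ
    exact hCy τ hτ

end Sys

namespace Sys

variable {c : ℝ} {O S T a b : ℝ → ℝ}

/-- near vacuum type I, `Ω` decays exponentially -/
lemma O_growth (H : Sys c O S T a b) (hO : Tendsto O atBot (𝓝 0))
    (hK : Tendsto (fun τ => (a τ - b τ) ^ 2) atBot (𝓝 0)) :
    ∀ᶠ τ in atBot, c * O τ ≤ (2 * c - 2 * (3/2 * (a τ - b τ) ^ 2 + c * O τ)) * O τ := by
  have hc := H.c0
  have h : Tendsto (fun τ => 2 * c - 2 * (3/2 * (a τ - b τ) ^ 2 + c * O τ)) atBot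
      (𝓝 (2 * c)) := by
    have := (tendsto_const_nhds (x := 2 * c)).sub
      (((hK.const_mul (3/2)).add (hO.const_mul c)).const_mul 2)
    simpa using this
  filter_upwards [h.eventually (eventually_gt_nhds (show c < 2 * c by linarith))] with τ hτ
  exact mul_le_mul_of_nonneg_right hτ.le (H.hO τ)

/-- The solution cannot converge to the Taub point `(-1, 0)`. -/
lemma not_taub_point (H : Sys c O S T a b) (hS : Tendsto S atBot (𝓝 (-1))) : False := by
  have hc := H.c0
  have h1 : Tendsto (fun τ => 1 - S τ ^ 2) atBot (𝓝 0) := by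
    have := (tendsto_const_nhds (x := (1:ℝ))).sub (hS.pow 2)
    simpa using this
  have hO : Tendsto O atBot (𝓝 0) := by
    refine squeeze_zero H.hO (fun τ => ?_) h1
    nlinarith [H.con τ, sq_nonneg (T τ), sq_nonneg (a τ - b τ)]
  have hK : Tendsto (fun τ => (a τ - b τ) ^ 2) atBot (𝓝 0) := by
    have := h1.const_mul (4/3)
    rw [mul_zero] at this
    refine squeeze_zero (fun τ => sq_nonneg _) (fun τ => ?_) this
    nlinarith [H.con τ, sq_nonneg (T τ), H.hO τ]
  obtain ⟨T0, hT0⟩ := eventually_atBot.1 (H.O_growth hO hK)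
  have hle : ∀ τ ≤ T0, (1 + S τ) - O τ ≤ 0 := by
    refine anti_le_lim (f := fun τ => (1 + S τ) - O τ) (anti_of_deriv
      (fun τ _ => ((H.dS τ).const_add 1).sub (H.dO τ)) ?_) ?_
    · intro τ hτ
      have h2 := hT0 τ hτ
      have h3 := H.S_gt τ
      have h4 := H.hO τ
      have h5 : 0 ≤ (a τ - b τ) ^ 2 * (1 + S τ) := mul_nonneg (sq_nonneg _) (by linarith)
      have h6 : 0 ≤ c * O τ * (1 + S τ) := by
        have : 0 ≤ 1 + S τ := by linarith
        positivity
      nlinarith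
    · have := (hS.const_add 1).sub hO
      simpa using this
  have hanti : AntitoneOn (fun τ => (a τ * b τ) * Real.exp (-(4/c) * O τ)) (Iic T0) := by
    refine anti_of_deriv (fun τ _ => (H.dp τ).mul (((H.dO τ).const_mul (-(4/c))).exp)) ?_
    intro τ hτ
    have hp := mul_pos (H.ha τ) (H.hb τ)
    have h2 := hT0 τ hτ
    have h3 := hle τ hτ
    have h4 := H.hO τ
    have h5 : 4 - 2 * (3/2 * (a τ - b τ) ^ 2 + c * O τ) + 4 * S τ
        - (4/c) * ((2 * c - 2 * (3/2 * (a τ - b τ) ^ 2 + c * O τ)) * O τ) ≤ 0 := by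
      have h6 : (4/c) * (c * O τ) ≤
        (4/c) * ((2 * c - 2 * (3/2 * (a τ - b τ) ^ 2 + c * O τ)) * O τ) := by gcongr
      have h7 : (4/c) * (c * O τ) = 4 * O τ := by field_simp
      have : 0 ≤ c * O τ := by positivity
      nlinarith [sq_nonneg (a τ - b τ)]
    have h8 : 0 < (a τ * b τ) * Real.exp (-(4/c) * O τ) := by positivity
    have := mul_nonpos_of_nonneg_of_nonpos h8.le h5
    linear_combination this
  have hlim : Tendsto (fun τ => (a τ * b τ) * Real.exp (-(4/c) * O τ)) atBot (𝓝 0) := by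
    refine squeeze_zero (fun τ => ?_) (fun τ => ?_) H.p_tendsto
    · have hp := mul_pos (H.ha τ) (H.hb τ); positivity
    · have hp := mul_pos (H.ha τ) (H.hb τ)
      have h4 := H.hO τ
      have : Real.exp (-(4/c) * O τ) ≤ 1 := by
        rw [Real.exp_le_one_iff]
        have : 0 ≤ 4/c * O τ := by positivity
        linarith
      nlinarith
  have := anti_le_lim hanti hlim T0 le_rfl
  have hp := mul_pos (H.ha T0) (H.hb T0)
  have : 0 < (a T0 * b T0) * Real.exp (-(4/c) * O T0) := by positivity
  linarith

/-- The solution cannot converge to the special point `(1/2, √3/2)`. -/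
lemma not_special (H : Sys c O S T a b) (hO : Tendsto O atBot (𝓝 0))
    (ha : Tendsto a atBot (𝓝 0)) (hb : Tendsto b atBot (𝓝 0))
    (hS : Tendsto S atBot (𝓝 (1/2))) (hT : Tendsto T atBot (𝓝 (√3/2))) : False := by
  have hc := H.c0
  have hr := s3
  have hK : Tendsto (fun τ => (a τ - b τ) ^ 2) atBot (𝓝 0) := by
    simpa using (ha.sub hb).pow 2
  have hsig : Tendsto (fun τ => -(1/2) * S τ + √3/2 * T τ) atBot (𝓝 (1/2)) := by
    have := (hS.const_mul (-(1/2))).add (hT.const_mul (√3/2))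
    convert this using 2
    nlinarith
  have hrate : Tendsto (fun τ => 2 - (3/2 * (a τ - b τ) ^ 2 + c * O τ) + 2 * S τ
      + 2 * √3 * T τ) atBot (𝓝 6) := by
    have := (((tendsto_const_nhds (x := (2:ℝ))).sub
      ((hK.const_mul (3/2)).add (hO.const_mul c))).add (hS.const_mul 2)).add
      (hT.const_mul (2 * √3))
    convert this using 2
    nlinarith
  obtain ⟨T0, hT0⟩ := eventually_atBot.1 ((((H.O_growth hO hK).and
    (hsig.eventually (eventually_gt_nhds (show (0:ℝ) < 1/2 by norm_num)))).and
    ((hsig.eventually (eventually_lt_nhds (show (1/2:ℝ) < 1 by norm_num))).and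
    (hrate.eventually (eventually_gt_nhds (show (1:ℝ) < 6 by norm_num))))).and
    (ha.eventually (eventually_lt_nhds (show (0:ℝ) < 1 by norm_num))))
  have hL : ∀ τ ≤ T0, 1/2 ≤ (-(1/2) * S τ + √3/2 * T τ) + O τ + 3 * a τ := by
    refine mono_ge_lim (f := fun τ => (-(1/2) * S τ + √3/2 * T τ) + O τ + 3 * a τ)
      (mono_of_deriv (fun τ _ => ((((H.dS τ).const_mul (-(1/2))).add
        ((H.dT τ).const_mul (√3/2))).add (H.dO τ)).add ((H.da τ).const_mul 3)) ?_) ?_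
    · intro τ hτ
      obtain ⟨⟨⟨h1, h2⟩, h3, h4⟩, h5⟩ := hT0 τ hτ
      have hap := H.ha τ
      have hbp := H.hb τ
      have h6 : a τ ≤ (2 - (3/2 * (a τ - b τ) ^ 2 + c * O τ) + 2 * S τ
        + 2 * √3 * T τ) * a τ := by nlinarith
      have h7 : a τ ^ 2 ≤ a τ := by nlinarith
      have h8 : (3/2 * (a τ - b τ) ^ 2 + c * O τ) * (-(1/2) * S τ + √3/2 * T τ) ≤
          (3/2 * (a τ - b τ) ^ 2 + c * O τ) := by
        have h0 := H.hO τ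
        have : 0 ≤ (3/2 * (a τ - b τ) ^ 2 + c * O τ) := by positivity
        nlinarith
      have h9 := mul_pos hap hbp
      have h10 : √3 / 2 * (3/2 * √3 * (a τ ^ 2 - b τ ^ 2)) = 9/4 * (a τ ^ 2 - b τ ^ 2) := by
        linear_combination (3/4) * (a τ ^ 2 - b τ ^ 2) * hr
      nlinarith [sq_nonneg (b τ)]
    · have := (hsig.add hO).add (ha.const_mul 3)
      simpa using this
  have hanti : AntitoneOn (fun τ => b τ * Real.exp (-(4/c) * O τ + (-12) * a τ)) (Iic T0) := by
    refine anti_of_deriv (fun τ _ => (H.db τ).mul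
      ((((H.dO τ).const_mul (-(4/c))).add ((H.da τ).const_mul (-12))).exp)) ?_
    intro τ hτ
    obtain ⟨⟨⟨h1, h2⟩, h3, h4⟩, h5⟩ := hT0 τ hτ
    have hap := H.ha τ
    have hbp := H.hb τ
    have h0 := H.hO τ
    have h6 : a τ ≤ (2 - (3/2 * (a τ - b τ) ^ 2 + c * O τ) + 2 * S τ
        + 2 * √3 * T τ) * a τ := by nlinarith
    have h7 : 4 * O τ ≤
        (4/c) * ((2 * c - 2 * (3/2 * (a τ - b τ) ^ 2 + c * O τ)) * O τ) := by
      have h7 : (4/c) * (c * O τ) = 4 * O τ := by field_simp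
      rw [← h7]
      gcongr
    have h8 : (2 - (3/2 * (a τ - b τ) ^ 2 + c * O τ) + 2 * S τ - 2 * √3 * T τ)
       - (4/c) * ((2 * c - 2 * (3/2 * (a τ - b τ) ^ 2 + c * O τ)) * O τ)
       - 12 * ((2 - (3/2 * (a τ - b τ) ^ 2 + c * O τ) + 2 * S τ + 2 * √3 * T τ) * a τ) ≤ 0 := by
      have h9 := hL τ hτ
      have : 0 ≤ c * O τ := by positivity
      nlinarith [sq_nonneg (a τ - b τ)]
    have h9 : 0 < b τ * Real.exp (-(4/c) * O τ + (-12) * a τ) := by positivity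
    have := mul_nonpos_of_nonneg_of_nonpos h9.le h8
    simp only [Pi.add_apply]
    linear_combination this
  have hlim : Tendsto (fun τ => b τ * Real.exp (-(4/c) * O τ + (-12) * a τ)) atBot (𝓝 0) := by
    refine squeeze_zero (fun τ => ?_) (fun τ => ?_) hb
    · have hp := H.hb τ; positivity
    · have hp := H.hb τ
      have hap := H.ha τ
      have h4 := H.hO τ
      have : Real.exp (-(4/c) * O τ + (-12) * a τ) ≤ 1 := by
        rw [Real.exp_le_one_iff]
        have : 0 ≤ 4/c * O τ := by positivity
        linarith
      nlinarith
  have := anti_le_lim hanti hlim T0 le_rfl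
  have hp := H.hb T0
  have : 0 < b T0 * Real.exp (-(4/c) * O T0 + (-12) * a T0) := by positivity
  linarith

/-- if `a → 0` then its limiting rate is nonnegative -/
lemma rate_nonneg (H : Sys c O S T a b) (hO : Tendsto O atBot (𝓝 0))
    (ha : Tendsto a atBot (𝓝 0)) (hb : Tendsto b atBot (𝓝 0)) {s t : ℝ}
    (hS : Tendsto S atBot (𝓝 s)) (hT : Tendsto T atBot (𝓝 t)) :
    0 ≤ 1 + s + √3 * t := by
  by_contra hneg
  push Not at hneg
  have hK : Tendsto (fun τ => (a τ - b τ) ^ 2) atBot (𝓝 0) := by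
    simpa using (ha.sub hb).pow 2
  have hrate : Tendsto (fun τ => 2 - (3/2 * (a τ - b τ) ^ 2 + c * O τ) + 2 * S τ
      + 2 * √3 * T τ) atBot (𝓝 (2 * (1 + s + √3 * t))) := by
    have := (((tendsto_const_nhds (x := (2:ℝ))).sub
      ((hK.const_mul (3/2)).add (hO.const_mul c))).add (hS.const_mul 2)).add
      (hT.const_mul (2 * √3))
    convert this using 2
    ring
  obtain ⟨T0, hT0⟩ := eventually_atBot.1
    (hrate.eventually (eventually_lt_nhds (show 2 * (1 + s + √3 * t) < 0 by linarith)))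
  have hanti : AntitoneOn a (Iic T0) := anti_of_deriv (fun τ _ => H.da τ)
    (fun τ hτ => mul_nonpos_of_nonpos_of_nonneg (hT0 τ hτ).le (H.ha τ).le)
  have := anti_le_lim hanti ha T0 le_rfl
  linarith [H.ha T0]

/-- an antiderivative of `2 - q` -/
lemma exists_I (H : Sys c O S T a b) : ∃ I : ℝ → ℝ, ∀ τ,
    HasDerivAt I (3/2 * (a τ - b τ) ^ 2 + c * O τ) τ := by
  have hca : Continuous a := continuous_iff_continuousAt.2 fun τ => (H.da τ).continuousAt
  have hcb : Continuous b := continuous_iff_continuousAt.2 fun τ => (H.db τ).continuousAt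
  have hcO : Continuous O := continuous_iff_continuousAt.2 fun τ => (H.dO τ).continuousAt
  have hc : Continuous (fun τ => 3/2 * (a τ - b τ) ^ 2 + c * O τ) := by fun_prop
  exact ⟨fun τ => ∫ x in (0:ℝ)..τ, (3/2 * (a x - b x) ^ 2 + c * O x),
    fun τ => (hc.integral_hasStrictDerivAt 0 τ).hasDerivAt⟩

lemma _root_.WainwrightHsu.tendsto_of_sq {T : ℝ → ℝ} (hc : Continuous T) {t : ℝ} (ht : 0 < t)
    (h : Tendsto (fun τ => T τ ^ 2) atBot (𝓝 t)) :
    Tendsto T atBot (𝓝 (√t)) ∨ Tendsto T atBot (𝓝 (-√t)) := by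
  obtain ⟨T0, hT0⟩ := eventually_atBot.1 (h.eventually (eventually_gt_nhds ht))
  have habs : Tendsto (fun τ => |T τ|) atBot (𝓝 (√t)) := by
    have := (Real.continuous_sqrt.tendsto t).comp h
    simpa only [Function.comp_def, Real.sqrt_sq_eq_abs] using this
  have hne : ∀ τ ≤ T0, T τ ≠ 0 := fun τ hτ h0 => by
    have := hT0 τ hτ; simp [h0] at this
  rcases lt_or_gt_of_ne (hne T0 le_rfl) with hlt | hgt
  · right
    have : ∀ τ ≤ T0, T τ < 0 := by
      intro τ hτ
      by_contra hc'
      push Not at hc'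
      obtain ⟨x, hx, hx0⟩ := intermediate_value_Icc' hτ hc.continuousOn ⟨hlt.le, hc'⟩
      exact hne x hx.2 hx0
    refine habs.neg.congr' ?_
    filter_upwards [eventually_le_atBot T0] with τ hτ
    rw [abs_of_neg (this τ hτ)]; ring
  · left
    have : ∀ τ ≤ T0, 0 < T τ := by
      intro τ hτ
      by_contra hc'
      push Not at hc'
      obtain ⟨x, hx, hx0⟩ := intermediate_value_Icc hτ hc.continuousOn ⟨hc', hgt.le⟩
      exact hne x hx.2 hx0
    refine habs.congr' ?_
    filter_upwards [eventually_le_atBot T0] with τ hτ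
    rw [abs_of_pos (this τ hτ)]

/-- Case A: `2 - q` is integrable at `-∞`. -/
lemma caseA (H : Sys c O S T a b) {I : ℝ → ℝ}
    (hI : ∀ τ, HasDerivAt I (3/2 * (a τ - b τ) ^ 2 + c * O τ) τ) {l : ℝ}
    (hl : Tendsto I atBot (𝓝 l)) :
    ∃ s t : ℝ, s^2 + t^2 = 1 ∧ 1/2 < s ∧
      Tendsto O atBot (𝓝 0) ∧ Tendsto S atBot (𝓝 s) ∧ Tendsto T atBot (𝓝 t) ∧
      Tendsto a atBot (𝓝 0) ∧ Tendsto b atBot (𝓝 0) := by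
  have hc := H.c0
  have hr := s3
  have hw := deriv_tendsto (fun τ _ => hI τ) H.lbw hl
  have hO : Tendsto O atBot (𝓝 0) := by
    have := hw.const_mul (1/c)
    rw [mul_zero] at this
    refine squeeze_zero H.hO (fun τ => ?_) this
    have : (1/c) * (c * O τ) = O τ := by field_simp
    have h2 : 0 ≤ (1/c) * (3/2 * (a τ - b τ) ^ 2) := by positivity
    linarith
  have hK : Tendsto (fun τ => (a τ - b τ) ^ 2) atBot (𝓝 0) := by
    refine squeeze_zero (fun τ => sq_nonneg _) (fun τ => ?_) hw
    have := mul_nonneg hc.le (H.hO τ)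
    nlinarith [sq_nonneg (a τ - b τ)]
  have hab : Tendsto (fun τ => (a τ - b τ) ^ 2 + 2 * (a τ * b τ)) atBot (𝓝 0) := by
    simpa using hK.add (H.p_tendsto.const_mul 2)
  have ha : Tendsto a atBot (𝓝 0) := by
    apply tendsto_zero_of_sq
    exact squeeze_zero (fun τ => sq_nonneg _) (fun τ => by nlinarith [sq_nonneg (b τ)]) hab
  have hb : Tendsto b atBot (𝓝 0) := by
    apply tendsto_zero_of_sq
    exact squeeze_zero (fun τ => sq_nonneg _) (fun τ => by nlinarith [sq_nonneg (a τ)]) hab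
  have hP : ∃ m, Tendsto (fun τ => S τ * Real.exp (I τ)) atBot (𝓝 m) := by
    have hImono : MonotoneOn I (Iic 0) := mono_of_deriv (fun τ _ => hI τ) (fun τ _ => by
      have := mul_nonneg hc.le (H.hO τ); positivity)
    refine anti_conv (T := 0) (M := Real.exp (I 0)) (anti_of_deriv
      (fun τ _ => (H.dS τ).mul (hI τ).exp) ?_) ?_
    · intro τ _
      have : 0 ≤ 3/2 * (a τ - b τ) ^ 2 * Real.exp (I τ) := by positivity
      linarith
    · intro τ hτ
      have h1 := hImono (mem_Iic.2 hτ) (mem_Iic.2 le_rfl) hτ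
      have h2 := Real.exp_le_exp.2 h1
      have h3 := H.S_lt τ
      nlinarith [Real.exp_pos (I τ)]
  obtain ⟨m, hm⟩ := hP
  have hS : Tendsto S atBot (𝓝 (m * Real.exp (-l))) := by
    have := hm.mul ((Real.continuous_exp.tendsto _).comp hl.neg)
    refine this.congr (fun τ => ?_)
    simp only [Function.comp_def]
    rw [mul_assoc, ← Real.exp_add]
    simp
  set s := m * Real.exp (-l)
  have hT2 : Tendsto (fun τ => T τ ^ 2) atBot (𝓝 (1 - s ^ 2)) := by
    have := (((tendsto_const_nhds (x := (1:ℝ))).sub (hS.pow 2)).sub hO).sub (hK.const_mul (3/4))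
    simp only [mul_zero, sub_zero] at this
    refine this.congr (fun τ => ?_)
    have := H.con τ
    linarith
  have hTex : ∃ t, Tendsto T atBot (𝓝 t) := by
    have h0 : 0 ≤ 1 - s ^ 2 := ge_of_tendsto' hT2 (fun τ => sq_nonneg _)
    rcases h0.eq_or_lt with h0 | h0
    · rw [← h0] at hT2
      exact ⟨0, tendsto_zero_of_sq hT2⟩
    · rcases tendsto_of_sq (continuous_iff_continuousAt.2 fun τ => (H.dT τ).continuousAt) h0 hT2
        with h | h
      · exact ⟨_, h⟩
      · exact ⟨_, h⟩
  obtain ⟨t, hT⟩ := hTex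
  have hst : s ^ 2 + t ^ 2 = 1 := by
    have := tendsto_nhds_unique hT2 (hT.pow 2)
    linarith
  have r1 := H.rate_nonneg hO ha hb hS hT
  have r2 := H.swap.rate_nonneg hO hb ha hS hT.neg
  refine ⟨s, t, hst, ?_, hO, hS, hT, ha, hb⟩
  have hs1 : s ≠ -1 := fun h => H.not_taub_point (h ▸ hS)
  have hs2 : -1 < s := lt_of_le_of_ne (by nlinarith [sq_nonneg t]) (Ne.symm hs1)
  have hge : 1/2 ≤ s := by
    have h3 : 0 ≤ (1 + s) ^ 2 - 3 * t ^ 2 := by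
      have := mul_nonneg r1 r2
      nlinarith
    have h4 : 0 ≤ (1 + s) * (4 * s - 2) := by nlinarith
    have := nonneg_of_mul_nonneg_right h4 (by linarith)
    linarith
  refine lt_of_le_of_ne hge ?_
  intro hs
  rw [← hs] at hS hst
  have ht : (t - √3/2) * (t + √3/2) = 0 := by nlinarith
  rcases mul_eq_zero.1 ht with h | h
  · exact H.not_special hO ha hb hS (by convert hT using 2; linarith)
  · exact H.swap.not_special hO hb ha hS (by convert hT.neg using 2; linarith)

end Sys

namespace Sys

variable {c : ℝ} {O S T a b : ℝ → ℝ}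

/-- The a priori information obtained in Case B, where `∫ (2 - q)` diverges at `-∞`. -/
lemma caseB_basic (H : Sys c O S T a b) {I : ℝ → ℝ}
    (hI : ∀ τ, HasDerivAt I (3/2 * (a τ - b τ) ^ 2 + c * O τ) τ)
    (hl : Tendsto I atBot atBot) (τ : ℝ) :
    S τ ≤ 0 ∧ O τ ≤ 2 * (1 + S τ) ∧ 1 - O τ ≤ -2 * S τ ∧ (1 + S τ) ^ 2 ≤ O τ := by
  have hc := H.c0
  have hE : Tendsto (fun τ => Real.exp (I τ)) atBot (𝓝 0) := Real.tendsto_exp_atBot.comp hl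
  have hE2 : Tendsto (fun τ => Real.exp (I τ) ^ 2) atBot (𝓝 0) := by simpa using hE.pow 2
  have dE : ∀ τ, HasDerivAt (fun τ => Real.exp (I τ))
    (Real.exp (I τ) * (3/2 * (a τ - b τ) ^ 2 + c * O τ)) τ := fun τ => (hI τ).exp
  have dE2 : ∀ τ, HasDerivAt (fun τ => Real.exp (I τ) ^ 2)
    (2 * Real.exp (I τ) ^ 2 * (3/2 * (a τ - b τ) ^ 2 + c * O τ)) τ := fun τ => by
    refine ((dE τ).pow 2).congr_deriv ?_
    simp only [Nat.cast_ofNat, Nat.add_one_sub_one, pow_one]; ring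
  have bddlim : ∀ {f g : ℝ → ℝ} (M : ℝ), (∀ τ, |f τ| ≤ M) → Tendsto g atBot (𝓝 0) →
      Tendsto (fun τ => f τ * g τ) atBot (𝓝 0) := by
    intro f g M hf hg
    rw [tendsto_zero_iff_abs_tendsto_zero] at hg ⊢
    have := hg.const_mul M
    rw [mul_zero] at this
    refine squeeze_zero (fun τ => abs_nonneg _) (fun τ => ?_) this
    simp only [Function.comp_def]
    rw [abs_mul]
    exact mul_le_mul_of_nonneg_right (hf τ) (abs_nonneg _)
  have hSabs := H.S_abs
  have hOabs : ∀ τ, |O τ| ≤ 1 := fun τ => by rw [abs_of_nonneg (H.hO τ)]; exact H.O_le τ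
  have hS0 : ∀ τ, S τ ≤ 0 := by
    intro τ
    have := anti_le_lim (T := τ) (anti_of_deriv
      (fun τ _ => (H.dS τ).mul (dE τ)) ?_) (bddlim 1 hSabs hE) τ le_rfl
    · by_contra hpos
      push Not at hpos
      have := mul_pos hpos (Real.exp_pos (I τ))
      simp only [Pi.mul_apply] at *
      linarith
    · intro τ _
      have : 0 ≤ 3/2 * (a τ - b τ) ^ 2 * Real.exp (I τ) := by positivity
      linarith
  have hEpos : 0 < Real.exp (I τ) ^ 2 := by positivity
  refine ⟨hS0 τ, ?_, ?_, ?_⟩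
  · have := mono_ge_lim (T := τ) (f := fun τ => (1 + S τ + (-1/2) * O τ) * Real.exp (I τ) ^ 2)
      (mono_of_deriv (fun τ _ => (((H.dS τ).const_add 1).add ((H.dO τ).const_mul (-1/2))).mul
        (dE2 τ)) ?_) (bddlim (f := fun τ => (1 + S τ + (-1/2) * O τ)) 3 ?_ hE2) τ le_rfl
    · have := nonneg_of_mul_nonneg_left this hEpos
      linarith
    · intro τ _
      simp only [Pi.add_apply]
      have h1 := H.S_gt τ
      have h2 := H.hO τ
      have h3 : 0 ≤ (1 + S τ) * (3/2 * (a τ - b τ) ^ 2 + c * O τ) * Real.exp (I τ) ^ 2 := by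
        have : 0 ≤ 1 + S τ := by linarith
        positivity
      linear_combination h3
    · intro τ
      have h1 := abs_le.1 (hSabs τ)
      have h2 := abs_le.1 (hOabs τ)
      rw [abs_le]; constructor <;> linarith
  · have := mono_ge_lim (T := τ) (f := fun τ => (-2 * S τ + O τ - 1) * Real.exp (I τ) ^ 2)
      (mono_of_deriv (fun τ _ => ((((H.dS τ).const_mul (-2)).add (H.dO τ)).sub_const 1).mul
        (dE2 τ)) ?_) (bddlim (f := fun τ => (-2 * S τ + O τ - 1)) 4 ?_ hE2) τ le_rfl
    · have := nonneg_of_mul_nonneg_left this hEpos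
      linarith
    · intro τ _
      simp only [Pi.add_apply]
      have h1 := hS0 τ
      have h2 := H.hO τ
      have h3 : 0 ≤ 2 * (-S τ) * (3/2 * (a τ - b τ) ^ 2 + c * O τ) * Real.exp (I τ) ^ 2 := by
        have : 0 ≤ - S τ := by linarith
        positivity
      linear_combination h3
    · intro τ
      have h1 := abs_le.1 (hSabs τ)
      have h2 := abs_le.1 (hOabs τ)
      rw [abs_le]; constructor <;> linarith
  · have := anti_le_lim (T := τ) (f := fun τ => ((1 + S τ) ^ 2 - O τ) * Real.exp (I τ) ^ 2)
      (anti_of_deriv (fun τ _ => ((((H.dS τ).const_add 1).pow 2).sub (H.dO τ)).mul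
        (dE2 τ)) ?_) (bddlim (f := fun τ => ((1 + S τ) ^ 2 - O τ)) 5 ?_ hE2) τ le_rfl
    · by_contra hpos
      push Not at hpos
      have := mul_pos (sub_pos.2 hpos) hEpos
      linarith
    · intro τ _
      simp only [Pi.sub_apply, Pi.pow_apply, Nat.cast_ofNat, Nat.add_one_sub_one, pow_one]
      have h1 := hS0 τ
      have h2 := H.hO τ
      have h3 : 0 ≤ 2 * c * (O τ) * (- S τ) * Real.exp (I τ) ^ 2 := by
        have : 0 ≤ - S τ := by linarith
        positivity
      linear_combination h3
    · intro τ
      have h1 := abs_le.1 (hSabs τ)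
      have h2 := abs_le.1 (hOabs τ)
      rw [abs_le]; constructor <;> nlinarith

/-- In Case B, `1 + Σ₊` is bounded below. -/
lemma caseB_h (H : Sys c O S T a b) {I : ℝ → ℝ}
    (hI : ∀ τ, HasDerivAt I (3/2 * (a τ - b τ) ^ 2 + c * O τ) τ)
    (hl : Tendsto I atBot atBot) : ∃ δ > 0, ∀ τ, δ ≤ 1 + S τ := by
  have hc := H.c0
  have hB := H.caseB_basic hI hl
  have hhpos : ∀ τ, 0 < 1 + S τ := fun τ => by linarith [H.S_gt τ]
  set δ : ℝ := c / (8 + 4 * c) with hδ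
  have hδ0 : 0 < δ := by positivity
  have hK : ∀ τ, 3/4 * (a τ - b τ) ^ 2 ≤ 2 * (1 + S τ) := fun τ => by
    nlinarith [H.con τ, sq_nonneg (T τ), H.hO τ, sq_nonneg (1 + S τ)]
  have hgrow : ∀ τ, 1 + S τ ≤ δ →
      0 ≤ (2 * c - 2 * (3/2 * (a τ - b τ) ^ 2 + c * O τ)) - c := by
    intro τ hτ
    have h1 := hK τ
    have h2 := (hB τ).2.1
    have h3 : (8 + 4 * c) * (1 + S τ) ≤ c := by
      have : (8 + 4 * c) * δ = c := by rw [hδ]; field_simp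
      nlinarith
    have h4 : c * O τ ≤ c * (2 * (1 + S τ)) := by gcongr
    nlinarith
  have dOe : ∀ τ, HasDerivAt (fun τ => O τ * Real.exp (-c * τ))
      (((2 * c - 2 * (3/2 * (a τ - b τ) ^ 2 + c * O τ)) - c) * (O τ * Real.exp (-c * τ))) τ := by
    intro τ
    refine ((H.dO τ).mul ((hasDerivAt_id τ).const_mul (-c)).exp).congr_deriv ?_
    simp only [id]
    ring
  have hcS : Continuous S := continuous_iff_continuousAt.2 fun τ => (H.dS τ).continuousAt
  refine ⟨(1/δ + 4/(c * δ^2))⁻¹, by positivity, fun τ1 => ?_⟩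
  by_cases hsmall : δ ≤ 1 + S τ1
  · refine le_trans ?_ hsmall
    rw [inv_le_comm₀ (by positivity) hδ0, ← one_div]
    have : 0 ≤ 4 / (c * δ^2) := by positivity
    linarith
  push Not at hsmall
  by_cases hex : ∃ τ ≤ τ1, δ ≤ 1 + S τ
  · -- last time before `τ1` where `δ ≤ 1 + S`
    obtain ⟨τ2, h21, h2⟩ := hex
    have hcpt : IsCompact (Icc τ2 τ1 ∩ {τ | δ ≤ 1 + S τ}) :=
      isCompact_Icc.inter_right (isClosed_le continuous_const (continuous_const.add hcS))
    obtain ⟨τ0, hτ0, hmax⟩ := hcpt.exists_isGreatest ⟨τ2, ⟨le_rfl, h21⟩, h2⟩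
    have h01 : τ0 ≤ τ1 := hτ0.1.2
    have hin : ∀ τ, τ0 < τ → τ ≤ τ1 → 1 + S τ ≤ δ := by
      intro τ h3 h4
      by_contra h5
      push Not at h5
      have := hmax ⟨⟨hτ0.1.1.trans h3.le, h4⟩, h5.le⟩
      linarith
    have hOm : O τ0 * Real.exp (-c * τ0) ≤ O τ1 * Real.exp (-c * τ1) := by
      have : MonotoneOn (fun τ => O τ * Real.exp (-c * τ)) (Icc τ0 τ1) := by
        apply monotoneOn_of_deriv_nonneg (convex_Icc _ _)
        · intro x _; exact (dOe x).continuousAt.continuousWithinAt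
        · intro x _; exact (dOe x).differentiableAt.differentiableWithinAt
        · intro x hx
          rw [interior_Icc] at hx
          rw [(dOe x).deriv]
          have := hgrow x (hin x hx.1 hx.2.le)
          have := H.hO x
          positivity
      exact this ⟨le_rfl, h01⟩ ⟨h01, le_rfl⟩ h01
    have hOm2 : δ ^ 2 * Real.exp (c * (τ1 - τ0)) ≤ 1 := by
      have h3 : O τ0 * Real.exp (c * (τ1 - τ0)) ≤ O τ1 := by
        have := mul_le_mul_of_nonneg_right hOm (Real.exp_pos (c * τ1)).le
        rw [mul_assoc, mul_assoc, ← Real.exp_add, ← Real.exp_add] at this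
        rw [show -c * τ1 + c * τ1 = 0 by ring, Real.exp_zero, mul_one,
          show -c * τ0 + c * τ1 = c * (τ1 - τ0) by ring] at this
        exact this
      refine le_trans ?_ (h3.trans (H.O_le τ1))
      have h4 : δ ^ 2 ≤ O τ0 := by
        have := (hB τ0).2.2.2
        have h5 : δ ≤ 1 + S τ0 := hτ0.2
        nlinarith
      gcongr
    have htime : τ1 - τ0 ≤ 1 / (c * δ^2) := by
      have h3 := Real.add_one_le_exp (c * (τ1 - τ0))
      have h4 : δ ^ 2 * (c * (τ1 - τ0)) ≤ 1 := by
        have : δ ^ 2 * (c * (τ1 - τ0) + 1) ≤ 1 := le_trans (by gcongr) hOm2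
        nlinarith [sq_nonneg δ]
      rw [le_div_iff₀ (by positivity)]
      linarith
    have hinv : (1 + S τ1)⁻¹ - 4 * τ1 ≤ (1 + S τ0)⁻¹ - 4 * τ0 := by
      have : AntitoneOn (fun τ => (1 + S τ)⁻¹ - 4 * τ) (Iic τ1) := by
        refine anti_of_deriv (fun τ _ => (((H.dS τ).const_add 1).inv (hhpos τ).ne').sub
          ((hasDerivAt_id τ).const_mul 4)) ?_
        intro τ _
        have h1 := hK τ
        have h2 := hhpos τ
        have h3 := (hB τ).1
        have h4 := H.hO τ
        rw [sub_nonpos, div_le_iff₀ (by positivity)]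
        have h5 : 0 ≤ c * O τ * (- S τ) := by
          have : 0 ≤ - S τ := by linarith
          positivity
        nlinarith
      exact this (mem_Iic.2 h01) (mem_Iic.2 le_rfl) h01
    have h5 : (1 + S τ0)⁻¹ ≤ 1/δ := by
      rw [one_div]; exact inv_anti₀ hδ0 hτ0.2
    have h6 : (1 + S τ1)⁻¹ ≤ 1/δ + 4/(c * δ^2) := by
      have : 4/(c * δ^2) = 4 * (1/(c * δ^2)) := by ring
      rw [this]
      linarith
    rw [inv_le_comm₀ (by positivity) (hhpos τ1)]
    exact h6
  · exfalso
    push Not at hex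
    have hmono : MonotoneOn (fun τ => O τ * Real.exp (-c * τ)) (Iic τ1) := by
      refine mono_of_deriv (fun τ _ => dOe τ) ?_
      intro τ hτ
      have := hgrow τ (hex τ hτ).le
      have := H.hO τ
      positivity
    have hexp : Tendsto (fun τ => Real.exp (-c * τ1) * Real.exp (c * τ)) atBot (𝓝 0) := by
      have h1 : Tendsto (fun τ => c * τ) atBot atBot := tendsto_id.const_mul_atBot hc
      have := (Real.tendsto_exp_atBot.comp h1).const_mul (Real.exp (-c * τ1))
      simpa using this
    have hO : Tendsto O atBot (𝓝 0) := by
      refine squeeze_zero' (Eventually.of_forall H.hO) ?_ hexp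
      filter_upwards [eventually_le_atBot τ1] with τ hτ
      have h1 := hmono (mem_Iic.2 hτ) (mem_Iic.2 le_rfl) hτ
      simp only at h1
      have h2 := mul_le_mul_of_nonneg_right h1 (Real.exp_pos (c * τ)).le
      rw [mul_assoc, ← Real.exp_add, show -c * τ + c * τ = 0 by ring, Real.exp_zero, mul_one,
        mul_assoc] at h2
      refine h2.trans ?_
      have := H.O_le τ1
      have h3 : 0 < Real.exp (-c * τ1) * Real.exp (c * τ) := by positivity
      nlinarith
    have hS : Tendsto (fun τ => 1 + S τ) atBot (𝓝 0) := by
      apply tendsto_zero_of_sq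
      exact squeeze_zero (fun τ => sq_nonneg _) (fun τ => (hB τ).2.2.2) hO
    apply H.not_taub_point
    have := hS.add_const (-1)
    rw [zero_add] at this
    refine this.congr (fun τ => by ring)

end Sys

namespace Sys

variable {c : ℝ} {O S T a b : ℝ → ℝ}

lemma w_bounds (H : Sys c O S T a b) (τ : ℝ) :
    0 ≤ 3/2 * (a τ - b τ) ^ 2 + c * O τ ∧ 3/2 * (a τ - b τ) ^ 2 + c * O τ ≤ 2 := by
  have h1 := H.con τ
  have h2 := H.hO τ
  have h3 := H.c0
  have h4 := H.c2
  constructor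
  · positivity
  · nlinarith [sq_nonneg (S τ), sq_nonneg (T τ)]

/-- The main Lyapunov function for the decay of `ab`. -/
lemma dL (H : Sys c O S T a b) (hOp : ∀ τ, 0 < O τ) (hD : ∀ τ, 0 < 1 + (1 - c/2) * S τ) (τ : ℝ) :
    HasDerivAt (fun τ => (2 - c) * Real.log (a τ * b τ) + 2 * Real.log (O τ)
      - 2 * (4 - c) * Real.log (1 + (1 - c/2) * S τ))
    ((2 * c * (4 - c) * T τ ^ 2 + 8 * (S τ + (1 - c/2)) ^ 2) / (1 + (1 - c/2) * S τ)) τ := by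
  have hp := mul_pos (H.ha τ) (H.hb τ)
  refine ((((H.dp τ).log hp.ne').const_mul (2 - c)).add
    (((H.dO τ).log (hOp τ).ne').const_mul 2)).sub
    (((((H.dS τ).const_mul (1 - c/2)).const_add 1).log (hD τ).ne').const_mul (2 * (4 - c)))
    |>.congr_deriv ?_
  have h1 := (hD τ).ne'
  have h2 := (hOp τ).ne'
  rw [mul_div_cancel_right₀ _ hp.ne', mul_div_cancel_right₀ _ h2, eq_div_iff h1, sub_mul,
    mul_assoc (2 * (4 - c)), div_mul_cancel₀ _ h1]
  linear_combination (-2 * c * (4 - c)) * H.con τ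

lemma dpsi (H : Sys c O S T a b) (τ : ℝ) :
    HasDerivAt (fun τ => T τ * (a τ ^ 2 - b τ ^ 2))
    (-(3/2 * √3) * (a τ ^ 2 - b τ ^ 2) ^ 2
      + (4 - 3 * (3/2 * (a τ - b τ) ^ 2 + c * O τ) + 4 * S τ) * T τ * (a τ ^ 2 - b τ ^ 2)
      + 4 * √3 * T τ ^ 2 * (a τ ^ 2 + b τ ^ 2)) τ := by
  refine ((H.dT τ).mul (((H.da τ).pow 2).sub ((H.db τ).pow 2))).congr_deriv ?_
  simp only [Pi.sub_apply, Pi.pow_apply, Nat.cast_ofNat, Nat.add_one_sub_one, pow_one]; ring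

lemma sqrt3_bounds : (3/2 : ℝ) ≤ √3 ∧ √3 ≤ 2 := by
  constructor
  · exact Real.le_sqrt_of_sq_le (by norm_num)
  · exact Real.sqrt_le_iff.2 ⟨by norm_num, by norm_num⟩

lemma psi_bound (H : Sys c O S T a b) {M : ℝ} (hM1 : 1 ≤ M) {τ : ℝ} (hM : a τ ≤ M ∧ b τ ≤ M) :
    -(3/2 * √3) * (a τ ^ 2 - b τ ^ 2) ^ 2
      + (4 - 3 * (3/2 * (a τ - b τ) ^ 2 + c * O τ) + 4 * S τ) * T τ * (a τ ^ 2 - b τ ^ 2)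
      + 4 * √3 * T τ ^ 2 * (a τ ^ 2 + b τ ^ 2)
    ≤ - (a τ ^ 2 - b τ ^ 2) ^ 2 + 16 * (1 + M ^ 2) * T τ ^ 2 := by
  obtain ⟨h1, h2⟩ := sqrt3_bounds
  obtain ⟨w0, w2⟩ := H.w_bounds τ
  have hS := abs_le.1 (H.S_abs τ)
  have ha := H.ha τ
  have hb := H.hb τ
  set w := 3/2 * (a τ - b τ) ^ 2 + c * O τ
  set d := a τ ^ 2 - b τ ^ 2
  have e1 : (3/2 * √3) * d ^ 2 ≥ 2 * d ^ 2 := by nlinarith [sq_nonneg d]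
  have e2 : (4 - 3 * w + 4 * S τ) * T τ * d ≤ d ^ 2 + 16 * T τ ^ 2 := by
    have hr : (4 - 3 * w + 4 * S τ) ^ 2 ≤ 64 := by
      nlinarith
    nlinarith [sq_nonneg ((4 - 3 * w + 4 * S τ) * T τ - 2 * d), sq_nonneg (T τ),
      mul_le_mul_of_nonneg_right hr (sq_nonneg (T τ))]
  have e3 : a τ ^ 2 + b τ ^ 2 ≤ 2 * M ^ 2 := by nlinarith [hM.1, hM.2]
  have e4 : 4 * √3 * T τ ^ 2 * (a τ ^ 2 + b τ ^ 2) ≤ 8 * T τ ^ 2 * (2 * M ^ 2) := by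
    have : 4 * √3 ≤ 8 := by linarith
    gcongr
  linarith

set_option maxHeartbeats 1600000 in
/-- Exponential decay of `ab` in Case B. -/
lemma p_exp (H : Sys c O S T a b) {ω : ℝ} (hω : 0 < ω) (hO : ∀ τ, ω ≤ O τ)
    (hS0 : ∀ τ, S τ ≤ 0) : ∃ C > 0, ∃ κ > 0, ∀ τ ≤ 0, a τ * b τ ≤ C * Real.exp (κ * τ) := by
  have hc := H.c0
  have hc2 := H.c2
  obtain ⟨M, hM1, hM⟩ := H.ab_bdd
  have hOp : ∀ τ, 0 < O τ := fun τ => hω.trans_le (hO τ)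
  set v : ℝ := 1 - c/2 with hv
  have hv0 : 0 < v := by rw [hv]; linarith
  have hv1 : v < 1 := by rw [hv]; linarith
  have hD : ∀ τ, 0 < 1 + v * S τ := fun τ => by nlinarith [H.S_gt τ]
  have hD1 : ∀ τ, 1 + v * S τ ≤ 1 := fun τ => by nlinarith [hS0 τ]
  set ε1 : ℝ := c / (4 * (1 + M ^ 2)) with hε1
  have hpos_one : 0 < ε1 := by positivity
  have heq_one : ε1 * (16 * (1 + M ^ 2)) = 4 * c := by rw [hε1]; field_simp; ring
  set k : ℝ := c * ω with hk
  have hkp : 0 < k := by positivity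
  set Q : ℝ := k ^ 2 / 32 + 9 / (16 * ε1) with hQ
  have hQp : 0 < Q := by positivity
  set ε2 : ℝ := k * v / (2 * Q) with hε2
  have hpos_two : 0 < ε2 := by positivity
  set η : ℝ := ε2 * k * v / 2 with hη
  have hηp : 0 < η := by positivity
  have hη2 : ε2 * k * v - ε2 ^ 2 * Q = η := by
    rw [hη, hε2]; field_simp; ring
  let L : ℝ → ℝ := fun τ => (2 - c) * Real.log (a τ * b τ) + 2 * Real.log (O τ)
      - 2 * (4 - c) * Real.log (1 + v * S τ)
  let J : ℝ → ℝ := fun τ => L τ - ε1 * (T τ * (a τ ^ 2 - b τ ^ 2)) + ε2 * S τ - η * τ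
  have hJ : MonotoneOn J (Iic 0) := by
    refine mono_of_deriv (fun τ _ => ((((H.dL hOp hD τ).sub ((H.dpsi τ).const_mul ε1)).add
      ((H.dS τ).const_mul ε2)).sub ((hasDerivAt_id τ).const_mul η))) ?_
    intro τ hτ
    have h1 := H.psi_bound hM1 (hM τ hτ)
    have h2 : 4 * c * T τ ^ 2 + 8 * (S τ + v) ^ 2 ≤
        (2 * c * (4 - c) * T τ ^ 2 + 8 * (S τ + v) ^ 2) / (1 + v * S τ) := by
      rw [le_div_iff₀ (hD τ)]
      have h3 : 4 * c * T τ ^ 2 ≤ 2 * c * (4 - c) * T τ ^ 2 := by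
        have : 0 ≤ c * T τ ^ 2 := by positivity
        nlinarith
      have h4 : 0 ≤ 4 * c * T τ ^ 2 + 8 * (S τ + v) ^ 2 := by positivity
      nlinarith [hD1 τ]
    have h5 := mul_le_mul_of_nonneg_left h1 hpos_one.le
    have h6 : ε1 * (-(a τ ^ 2 - b τ ^ 2) ^ 2 + 16 * (1 + M ^ 2) * T τ ^ 2)
        = - ε1 * (a τ ^ 2 - b τ ^ 2) ^ 2 + 4 * c * T τ ^ 2 := by
      linear_combination heq_one * T τ ^ 2
    have h7 : (a τ - b τ) ^ 2 ≤ |a τ ^ 2 - b τ ^ 2| := by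
      rw [show a τ ^ 2 - b τ ^ 2 = (a τ - b τ) * (a τ + b τ) by ring, abs_mul,
        ← sq_abs, _root_.pow_two]
      have ha := H.ha τ
      have hb := H.hb τ
      refine mul_le_mul_of_nonneg_left ?_ (abs_nonneg _)
      rw [abs_le, abs_of_pos (by linarith : 0 < a τ + b τ)]
      constructor <;> linarith
    have h8 : -(k * S τ) - 3/2 * |a τ ^ 2 - b τ ^ 2| ≤
        -(3/2 * (a τ - b τ) ^ 2 + c * O τ) * S τ - 3/2 * (a τ - b τ) ^ 2 := by
      have e1 : 0 ≤ c * (O τ - ω) * (- S τ) := by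
        have := hO τ
        have := hS0 τ
        have e2 : 0 ≤ O τ - ω := by linarith
        have e3 : 0 ≤ - S τ := by linarith
        positivity
      have e4 : 0 ≤ 3/2 * (a τ - b τ) ^ 2 * (- S τ) := by
        have := hS0 τ
        have e3 : 0 ≤ - S τ := by linarith
        positivity
      rw [hk]
      linarith
    have h9 := mul_le_mul_of_nonneg_left h8 hpos_two.le
    have h10 : ε2 * k * (S τ + v) ≤ 8 * (S τ + v) ^ 2 + ε2 ^ 2 * (k ^ 2 / 32) := by
      linear_combination (1/32) * sq_nonneg (16 * (S τ + v) - ε2 * k)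
    have h11 : 3/2 * ε2 * |a τ ^ 2 - b τ ^ 2| ≤
        ε1 * (a τ ^ 2 - b τ ^ 2) ^ 2 + ε2 ^ 2 * (9 / (16 * ε1)) := by
      rw [← sq_abs (a τ ^ 2 - b τ ^ 2)]
      set x := |a τ ^ 2 - b τ ^ 2|
      have : ε1 * x ^ 2 + ε2 ^ 2 * (9 / (16 * ε1)) - 3/2 * ε2 * x
          = ε1 * (x - 3 * ε2 / (4 * ε1)) ^ 2 := by
        field_simp; ring
      have h12 : 0 ≤ ε1 * (x - 3 * ε2 / (4 * ε1)) ^ 2 := by positivity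
      linarith
    have h12 : ε2 ^ 2 * Q = ε2 ^ 2 * (k ^ 2 / 32) + ε2 ^ 2 * (9 / (16 * ε1)) := by rw [hQ]; ring
    rw [mul_one]
    linarith
  set A : ℝ := J 0 - 2 * Real.log ω + ε1 * (2 * M ^ 2) + ε2 with hA
  have h2c : 0 < 2 - c := by linarith
  refine ⟨Real.exp (A / (2 - c)), Real.exp_pos _, η / (2 - c), by positivity, fun τ hτ => ?_⟩
  have hp := mul_pos (H.ha τ) (H.hb τ)
  rw [← Real.exp_add, ← Real.log_le_iff_le_exp hp, div_mul_eq_mul_div, ← add_div,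
    le_div_iff₀ h2c]
  have h1 := hJ (mem_Iic.2 hτ) (mem_Iic.2 le_rfl) hτ
  have h2 : J τ = (2 - c) * Real.log (a τ * b τ) + 2 * Real.log (O τ)
      - 2 * (4 - c) * Real.log (1 + v * S τ) - ε1 * (T τ * (a τ ^ 2 - b τ ^ 2)) + ε2 * S τ
      - η * τ := rfl
  have h3 : Real.log ω ≤ Real.log (O τ) := Real.log_le_log hω (hO τ)
  have h4 : Real.log (1 + v * S τ) ≤ 0 := Real.log_nonpos (hD τ).le (hD1 τ)
  have h5 : T τ * (a τ ^ 2 - b τ ^ 2) ≤ 2 * M ^ 2 := by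
    have := abs_le.1 (H.T_abs τ)
    have h6 := H.ha τ
    have h7 := H.hb τ
    have h8 := hM τ hτ
    have h9 : a τ ^ 2 ≤ M ^ 2 := by gcongr; exact h8.1
    have h10 : b τ ^ 2 ≤ M ^ 2 := by gcongr; exact h8.2
    nlinarith [sq_nonneg (a τ), sq_nonneg (b τ)]
  have h6 := mul_le_mul_of_nonneg_left h5 hpos_one.le
  have h7 : -1 < S τ := H.S_gt τ
  have h8 : ε2 * (-1) ≤ ε2 * S τ := by gcongr
  have h9 : 2 * (4 - c) * Real.log (1 + v * S τ) ≤ 0 := by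
    have : 0 ≤ 2 * (4 - c) := by linarith
    exact mul_nonpos_of_nonneg_of_nonpos this h4
  linarith

end Sys

lemma bd_mul_tendsto {f g : ℝ → ℝ} (hf : Bd f) (hg : Tendsto g atBot (𝓝 0)) :
    Tendsto (fun τ => f τ * g τ) atBot (𝓝 0) := by
  obtain ⟨M, hM⟩ := hf
  rw [tendsto_zero_iff_abs_tendsto_zero] at hg ⊢
  have := hg.const_mul M
  rw [mul_zero] at this
  refine squeeze_zero' (Eventually.of_forall fun τ => abs_nonneg _) ?_ this
  filter_upwards [eventually_le_atBot 0] with τ hτ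
  simp only [Function.comp_def]
  rw [abs_mul]
  exact mul_le_mul_of_nonneg_right (hM τ hτ) (abs_nonneg _)

namespace Sys

variable {c : ℝ} {O S T a b : ℝ → ℝ}

/-- rotated shear variable -/
def sg (S T : ℝ → ℝ) (τ : ℝ) : ℝ := -(1/2) * S τ - √3/2 * T τ

/-- rotated shear variable, orthogonal direction -/
def rr (S T : ℝ → ℝ) (τ : ℝ) : ℝ := √3/2 * S τ - 1/2 * T τ

/-- exponent of the type II Lyapunov function -/
def mm (c : ℝ) : ℝ := c * (2 - c) / ((2 + c) * (6 - c))

/-- logarithm of the type II Lyapunov function -/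
def zt (c : ℝ) (O S T a : ℝ → ℝ) (τ : ℝ) : ℝ :=
  2 * mm c * Real.log (a τ) + (1 - mm c) * Real.log (O τ)
    - 2 * Real.log (1 - (2 - c)/4 * sg S T τ)

/-- the positive definite part of its derivative -/
def Ph (c : ℝ) (S T : ℝ → ℝ) (τ : ℝ) : ℝ :=
  2 * c * rr S T τ ^ 2 + (8 * mm c * ((2 - c)/4) + 2 * c) * (sg S T τ - (2 - c)/4) ^ 2

lemma mm_pos (hc : 0 < c) (hc2 : c < 2) : 0 < mm c := by
  unfold mm
  have h1 : 0 < 2 - c := by linarith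
  have h2 : 0 < 6 - c := by linarith
  positivity

lemma mm_lt (hc : 0 < c) (hc2 : c < 2) : mm c < 1 := by
  unfold mm
  have h2 : 0 < 6 - c := by linarith
  rw [div_lt_one (by positivity)]
  nlinarith

lemma mm_eq (hc : 0 < c) (hc2 : c < 2) :
    (2 - c)/4 * (8 * mm c * ((2 - c)/4) + 2 * c) = 8 * mm c := by
  unfold mm
  have h2 : 6 - c ≠ 0 := by linarith
  have h3 : 2 + c ≠ 0 := by linarith
  field_simp
  ring

lemma sg_rr (S T : ℝ → ℝ) (τ : ℝ) : sg S T τ ^ 2 + rr S T τ ^ 2 = S τ ^ 2 + T τ ^ 2 := by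
  unfold sg rr
  linear_combination (1/4) * (S τ ^ 2 + T τ ^ 2) * s3

lemma sg_abs (H : Sys c O S T a b) (τ : ℝ) : |sg S T τ| ≤ 1 := by
  rw [abs_le]
  have := sg_rr S T τ
  constructor <;>
  nlinarith [H.con τ, sq_nonneg (rr S T τ), sq_nonneg (a τ - b τ), H.hO τ]

lemma D2_bounds (H : Sys c O S T a b) (τ : ℝ) :
    1/2 ≤ 1 - (2 - c)/4 * sg S T τ ∧ 1 - (2 - c)/4 * sg S T τ ≤ 2 := by
  have h1 := abs_le.1 (H.sg_abs τ)
  have h2 := H.c0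
  have h3 := H.c2
  constructor <;> nlinarith

lemma dsg (H : Sys c O S T a b) (τ : ℝ) : HasDerivAt (sg S T)
    (-(3/2 * (a τ - b τ) ^ 2 + c * O τ) * sg S T τ + 3 * (a τ - b τ) ^ 2
      - 9/2 * (b τ ^ 2 - a τ * b τ)) τ := by
  refine (((H.dS τ).const_mul (-(1/2))).sub ((H.dT τ).const_mul (√3/2))).congr_deriv ?_
  unfold sg
  linear_combination (3/4) * (a τ ^ 2 - b τ ^ 2) * s3

lemma dzt (H : Sys c O S T a b) (hOp : ∀ τ, 0 < O τ) (τ : ℝ) :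
    HasDerivAt (zt c O S T a)
    ((Ph c S T τ - 9 * ((2 - c)/4) * (b τ ^ 2 - a τ * b τ)) * (1 - (2 - c)/4 * sg S T τ)⁻¹) τ := by
  have hD : 0 < 1 - (2 - c)/4 * sg S T τ := by linarith [(H.D2_bounds τ).1]
  refine (((((H.da τ).log (H.ha τ).ne').const_mul (2 * mm c)).add
    (((H.dO τ).log (hOp τ).ne').const_mul (1 - mm c))).sub
    (((((H.dsg τ).const_mul ((2 - c)/4)).const_sub 1).log hD.ne').const_mul 2)).congr_deriv ?_
  have h1 := hD.ne'
  have h2 := (hOp τ).ne'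
  rw [mul_div_cancel_right₀ _ (H.ha τ).ne', mul_div_cancel_right₀ _ h2, ← div_eq_mul_inv,
    eq_div_iff h1, sub_mul, mul_assoc (2:ℝ) (_ / _), div_mul_cancel₀ _ h1]
  have h3 := mm_eq H.c0 H.c2
  have h4 := sg_rr S T τ
  have h5 : 2 * S τ + 2 * √3 * T τ = -4 * sg S T τ := by unfold sg; ring
  have h6 : 2 - (3/2 * (a τ - b τ) ^ 2 + c * O τ) + 2 * S τ + 2 * √3 * T τ
    = 2 - (3/2 * (a τ - b τ) ^ 2 + c * O τ) - 4 * sg S T τ := by linear_combination h5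
  rw [h6]
  unfold Ph
  linear_combination (-2 * c) * H.con τ + (-2 * c) * h4 + (sg S T τ - (2 - c)/4) * h3

end Sys

namespace Sys

variable {c : ℝ} {O S T a b : ℝ → ℝ}

lemma Ph_nonneg (hc : 0 < c) (hc2 : c < 2) (τ : ℝ) : 0 ≤ Ph c S T τ := by
  have h1 := mm_pos hc hc2
  have h2 : 0 < 2 - c := by linarith
  unfold Ph
  positivity

lemma lbsg (H : Sys c O S T a b) : LB (sg S T) :=
  ((LB.const _).mul H.lbS).sub ((LB.const _).mul H.lbT)

lemma lbrr (H : Sys c O S T a b) : LB (rr S T) :=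
  ((LB.const _).mul H.lbS).sub ((LB.const _).mul H.lbT)

lemma lbPh (H : Sys c O S T a b) : LB (Ph c S T) :=
  ((LB.const _).mul H.lbrr.sq).add ((LB.const _).mul (H.lbsg.sub (LB.const _)).sq)

lemma lbD (H : Sys c O S T a b) : LB (fun τ => 1 - (2 - c)/4 * sg S T τ) :=
  (LB.const _).sub ((LB.const _).mul H.lbsg)

lemma lbR (H : Sys c O S T a b) : LB (fun τ =>
    (Ph c S T τ - 9 * ((2 - c)/4) * (b τ ^ 2 - a τ * b τ)) * (1 - (2 - c)/4 * sg S T τ)⁻¹) :=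
  (H.lbPh.sub ((LB.const _).mul (H.lbb.sq.sub (H.lba.mul H.lbb)))).mul
    (H.lbD.inv (δ := 1/2) (by norm_num) (fun τ _ => (H.D2_bounds τ).1))

lemma logD (H : Sys c O S T a b) (τ : ℝ) :
    - Real.log 2 ≤ Real.log (1 - (2 - c)/4 * sg S T τ) ∧
    Real.log (1 - (2 - c)/4 * sg S T τ) ≤ Real.log 2 := by
  obtain ⟨h1, h2⟩ := H.D2_bounds τ
  constructor
  · rw [← Real.log_inv]
    exact Real.log_le_log (by norm_num) (by linarith)
  · exact Real.log_le_log (by linarith) h2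

/-- Convergence of the type II Lyapunov function. -/
lemma Z_conv (H : Sys c O S T a b) {ω : ℝ} (hω : 0 < ω) (hO : ∀ τ, ω ≤ O τ)
    (hS0 : ∀ τ, S τ ≤ 0) : ∃ z, 0 ≤ z ∧
      Tendsto (fun τ => Real.exp (zt c O S T a τ)) atBot (𝓝 z) ∧
      Tendsto (fun τ => Real.exp (zt c O S T a τ) * Ph c S T τ) atBot (𝓝 0) := by
  have hc := H.c0
  have hc2 := H.c2
  have hm := mm_pos hc hc2
  have hm1 := mm_lt hc hc2
  obtain ⟨C, hC, κ, hκ, hp⟩ := H.p_exp hω hO hS0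
  obtain ⟨M, hM1, hM⟩ := H.ab_bdd
  have hOp : ∀ τ, 0 < O τ := fun τ => hω.trans_le (hO τ)
  have hlO : ∀ τ, Real.log (O τ) ≤ 0 := fun τ => Real.log_nonpos (hOp τ).le (H.O_le τ)
  have hlM : 0 ≤ Real.log M := Real.log_nonneg hM1
  set R : ℝ → ℝ := fun τ =>
    (Ph c S T τ - 9 * ((2 - c)/4) * (b τ ^ 2 - a τ * b τ)) * (1 - (2 - c)/4 * sg S T τ)⁻¹ with hR
  have hd : ∀ τ, HasDerivAt (fun τ => Real.exp (zt c O S T a τ))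
      (Real.exp (zt c O S T a τ) * R τ) τ := fun τ => (H.dzt hOp τ).exp
  have hbd : Bd (fun τ => Real.exp (zt c O S T a τ)) := by
    refine ⟨Real.exp (2 * mm c * Real.log M + 2 * Real.log 2), fun τ hτ => ?_⟩
    rw [abs_of_pos (Real.exp_pos _), Real.exp_le_exp]
    unfold zt
    have h1 : Real.log (a τ) ≤ Real.log M := Real.log_le_log (H.ha τ) (hM τ hτ).1
    have h2 := hlO τ
    have h3 := (H.logD τ).1
    have h4 : 2 * mm c * Real.log (a τ) ≤ 2 * mm c * Real.log M := by gcongr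
    have h5 : (1 - mm c) * Real.log (O τ) ≤ 0 :=
      mul_nonpos_of_nonneg_of_nonpos (by linarith) h2
    linarith
  have hlbZ : LB (fun τ => Real.exp (zt c O S T a τ)) :=
    LB.mk hbd (fun τ _ => hd τ) (hbd.mul H.lbR.bd)
  -- decay of `Z b²`
  set κ' : ℝ := 2 * mm c * κ with hκ'
  have hκ'p : 0 < κ' := by positivity
  set B : ℝ := Real.exp (2 * mm c * Real.log C + (2 - 2 * mm c) * Real.log M + 2 * Real.log 2)
    with hB
  have hBp : 0 < B := Real.exp_pos _
  have hZb : ∀ τ ≤ 0, Real.exp (zt c O S T a τ) * b τ ^ 2 ≤ B * Real.exp (κ' * τ) := by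
    intro τ hτ
    have ha := H.ha τ
    have hb := H.hb τ
    have e1 : b τ ^ 2 = Real.exp (2 * Real.log (b τ)) := by
      rw [two_mul, Real.exp_add, Real.exp_log hb, _root_.pow_two]
    rw [e1, hB, ← Real.exp_add, ← Real.exp_add, Real.exp_le_exp]
    unfold zt
    have h1 : Real.log (a τ) + Real.log (b τ) ≤ Real.log C + κ * τ := by
      rw [← Real.log_mul ha.ne' hb.ne']
      have := Real.log_le_log (mul_pos ha hb) (hp τ hτ)
      rwa [Real.log_mul hC.ne' (Real.exp_pos _).ne', Real.log_exp] at this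
    have h2 : Real.log (b τ) ≤ Real.log M := Real.log_le_log hb (hM τ hτ).2
    have h3 := (H.logD τ).1
    have h4 : (2 * mm c) * (Real.log (a τ) + Real.log (b τ)) ≤
      (2 * mm c) * (Real.log C + κ * τ) := by gcongr
    have h5 : (1 - mm c) * Real.log (O τ) ≤ 0 :=
      mul_nonpos_of_nonneg_of_nonpos (by linarith) (hlO τ)
    have h6 : (2 - 2 * mm c) * Real.log (b τ) ≤ (2 - 2 * mm c) * Real.log M :=
      mul_le_mul_of_nonneg_left h2 (by linarith)
    rw [hκ']
    linarith
  have hexp0 : Tendsto (fun τ => Real.exp (κ' * τ)) atBot (𝓝 0) :=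
    Real.tendsto_exp_atBot.comp (tendsto_id.const_mul_atBot hκ'p)
  have hmono : MonotoneOn (fun τ => Real.exp (zt c O S T a τ) + 9 * B / κ' * Real.exp (κ' * τ))
      (Iic 0) := by
    refine mono_of_deriv (fun τ _ => (hd τ).add
      ((((hasDerivAt_id τ).const_mul κ').exp).const_mul (9 * B / κ'))) ?_
    intro τ hτ
    have h1 := hZb τ hτ
    have h2 : -9 * b τ ^ 2 ≤ R τ := by
      have hD := (H.D2_bounds τ).1
      rw [hR]
      simp only
      rw [← div_eq_mul_inv, le_div_iff₀ (by linarith)]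
      have h3 := Ph_nonneg (S := S) (T := T) hc hc2 τ
      have h4 := mul_pos (H.ha τ) (H.hb τ)
      have h5 : 0 ≤ 9 * ((2 - c)/4) * (a τ * b τ) := by
        have : 0 < 2 - c := by linarith
        positivity
      have h6 := mul_le_mul_of_nonneg_left hD (sq_nonneg (b τ))
      have h7 : (2 - c)/4 * b τ ^ 2 ≤ 1/2 * b τ ^ 2 :=
        mul_le_mul_of_nonneg_right (by linarith) (sq_nonneg _)
      linarith
    have h3 := mul_le_mul_of_nonneg_left h2 (Real.exp_pos (zt c O S T a τ)).le
    have h4 : 9 * B / κ' * (Real.exp (κ' * id τ) * (κ' * 1)) = 9 * (B * Real.exp (κ' * τ)) := by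
      simp only [id]; field_simp
    rw [h4]
    linarith
  obtain ⟨z, hz⟩ := mono_conv (M := 0) hmono (fun τ _ => by positivity)
  have hz' : Tendsto (fun τ => Real.exp (zt c O S T a τ)) atBot (𝓝 z) := by
    have := hz.sub (hexp0.const_mul (9 * B / κ'))
    simp only [mul_zero, sub_zero] at this
    exact this.congr (fun τ => by ring)
  refine ⟨z, ge_of_tendsto' hz' (fun τ => (Real.exp_pos _).le), hz', ?_⟩
  have hZ' := deriv_tendsto (fun τ _ => hd τ) (hlbZ.mul H.lbR) hz'
  have h1 : Tendsto (fun τ => Real.exp (zt c O S T a τ) * b τ ^ 2) atBot (𝓝 0) := by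
    have := hexp0.const_mul B
    rw [mul_zero] at this
    refine squeeze_zero' (Eventually.of_forall fun τ => by positivity) ?_ this
    filter_upwards [eventually_le_atBot 0] with τ hτ
    exact hZb τ hτ
  have h2 := bd_mul_tendsto hbd H.p_tendsto
  have h3 := (bd_mul_tendsto H.lbD.bd hZ').add ((h1.sub h2).const_mul (9 * ((2 - c)/4)))
  simp only [sub_zero, mul_zero, add_zero] at h3
  refine h3.congr (fun τ => ?_)
  have hD : 1 - (2 - c)/4 * sg S T τ ≠ 0 := by linarith [(H.D2_bounds τ).1]
  rw [hR]
  simp only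
  have h4 := mul_inv_cancel₀ hD
  linear_combination Real.exp (zt c O S T a τ) *
    (Ph c S T τ - 9 * ((2 - c)/4) * (b τ ^ 2 - a τ * b τ)) * h4

/-- Case B: either `a → 0` or the solution converges to the corresponding `P⁺(II)`. -/
lemma typeII (H : Sys c O S T a b) {ω : ℝ} (hω : 0 < ω) (hO : ∀ τ, ω ≤ O τ)
    (hS0 : ∀ τ, S τ ≤ 0) : Tendsto a atBot (𝓝 0) ∨
      (Tendsto O atBot (𝓝 (1 - (2 - c)/8)) ∧ Tendsto S atBot (𝓝 (-((2 - c)/8))) ∧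
        Tendsto T atBot (𝓝 (-(√3 * (2 - c)/8))) ∧
        (∃ l : ℝ, 0 < l ∧ Tendsto a atBot (𝓝 l)) ∧ Tendsto b atBot (𝓝 0)) := by
  have hc := H.c0
  have hc2 := H.c2
  have h2c : 0 < 2 - c := by linarith
  have hm := mm_pos hc hc2
  have hm1 := mm_lt hc hc2
  have hOp : ∀ τ, 0 < O τ := fun τ => hω.trans_le (hO τ)
  have hlO : ∀ τ, Real.log (O τ) ≤ 0 := fun τ => Real.log_nonpos (hOp τ).le (H.O_le τ)
  obtain ⟨z, hz0, hz, hzP⟩ := H.Z_conv hω hO hS0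
  rcases hz0.eq_or_lt with h0 | hzpos
  · left
    rw [← h0, Real.tendsto_exp_comp_nhds_zero] at hz
    have hla : Tendsto (fun τ => Real.log (a τ)) atBot atBot := by
      have h1 : Tendsto (fun τ => (2 * mm c)⁻¹ *
          (zt c O S T a τ + (- (1 - mm c) * Real.log ω + 2 * Real.log 2))) atBot atBot :=
        (tendsto_atBot_add_const_right _ _ hz).const_mul_atBot (by positivity)
      refine tendsto_atBot_mono (fun τ => ?_) h1
      rw [inv_mul_eq_div, le_div_iff₀ (by positivity)]
      unfold zt
      have h2 := (H.logD τ).2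
      have h3 : Real.log ω ≤ Real.log (O τ) := Real.log_le_log hω (hO τ)
      have h4 : (1 - mm c) * Real.log ω ≤ (1 - mm c) * Real.log (O τ) :=
        mul_le_mul_of_nonneg_left h3 (by linarith)
      linarith
    exact (Real.tendsto_exp_atBot.comp hla).congr (fun τ => Real.exp_log (H.ha τ))
  · right
    have hP : Tendsto (Ph c S T) atBot (𝓝 0) := by
      have := hzP.div hz hzpos.ne'
      rw [zero_div] at this
      refine this.congr (fun τ => ?_)
      have := (Real.exp_pos (zt c O S T a τ)).ne'
      simp only [Pi.div_apply]
      field_simp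
    have hr : Tendsto (rr S T) atBot (𝓝 0) := by
      apply tendsto_zero_of_sq
      have := hP.const_mul (2 * c)⁻¹
      rw [mul_zero] at this
      refine squeeze_zero (fun τ => sq_nonneg _) (fun τ => ?_) this
      rw [inv_mul_eq_div, le_div_iff₀ (by positivity)]
      unfold Ph
      have : 0 ≤ (8 * mm c * ((2 - c)/4) + 2 * c) * (sg S T τ - (2 - c)/4) ^ 2 := by positivity
      linarith
    have hs : Tendsto (sg S T) atBot (𝓝 ((2 - c)/4)) := by
      have : Tendsto (fun τ => sg S T τ - (2 - c)/4) atBot (𝓝 0) := by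
        apply tendsto_zero_of_sq
        have := hP.const_mul (8 * mm c * ((2 - c)/4) + 2 * c)⁻¹
        rw [mul_zero] at this
        refine squeeze_zero (fun τ => sq_nonneg _) (fun τ => ?_) this
        rw [inv_mul_eq_div, le_div_iff₀ (by positivity)]
        unfold Ph
        have : 0 ≤ 2 * c * rr S T τ ^ 2 := by positivity
        linarith
      have := this.add_const ((2 - c)/4)
      rw [zero_add] at this
      exact this.congr (fun τ => by ring)
    have hS : Tendsto S atBot (𝓝 (-((2 - c)/8))) := by
      have := (hs.const_mul (-(1/2))).add (hr.const_mul (√3/2))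
      rw [show -(1/2) * ((2 - c)/4) + √3/2 * 0 = -((2 - c)/8) by ring] at this
      refine this.congr (fun τ => ?_)
      unfold sg rr
      linear_combination (1/4) * S τ * s3
    have hT : Tendsto T atBot (𝓝 (-(√3 * (2 - c)/8))) := by
      have := (hs.const_mul (-(√3/2))).add (hr.const_mul (-(1/2)))
      rw [show -(√3/2) * ((2 - c)/4) + -(1/2) * 0 = -(√3 * (2 - c)/8) by ring] at this
      refine this.congr (fun τ => ?_)
      unfold sg rr
      linear_combination (1/4) * T τ * s3
    have hb : Tendsto b atBot (𝓝 0) := by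
      set α : ℝ := Real.exp ((Real.log (z/2) - 2 * Real.log 2) / (2 * mm c)) with hα
      have hαp : 0 < α := Real.exp_pos _
      have h1 : ∀ᶠ τ in atBot, α ≤ a τ := by
        filter_upwards [hz.eventually (lt_mem_nhds (half_lt_self hzpos))] with τ hτ
        rw [hα, ← Real.le_log_iff_exp_le (H.ha τ), div_le_iff₀ (by positivity)]
        have h2 : Real.log (z/2) < zt c O S T a τ := (Real.log_lt_iff_lt_exp (by linarith)).2 hτ
        unfold zt at h2
        have h3 := (H.logD τ).1
        have h5 : (1 - mm c) * Real.log (O τ) ≤ 0 :=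
          mul_nonpos_of_nonneg_of_nonpos (by linarith) (hlO τ)
        linarith
      have h2 := H.p_tendsto.const_mul α⁻¹
      rw [mul_zero] at h2
      refine squeeze_zero' (Eventually.of_forall fun τ => (H.hb τ).le) ?_ h2
      filter_upwards [h1] with τ hτ
      rw [inv_mul_eq_div, le_div_iff₀ hαp]
      have := mul_le_mul_of_nonneg_left hτ (H.hb τ).le
      linarith
    have hS' := deriv_tendsto (fun τ _ => H.dS τ)
      ((H.lbw.neg.mul H.lbS).sub ((LB.const _).mul (H.lba.sub H.lbb).sq)) hS
    have hST : Tendsto (fun τ => 1 - S τ ^ 2 - T τ ^ 2) atBot (𝓝 (1 - ((2 - c)/4) ^ 2)) := by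
      have := (tendsto_const_nhds (x := (1:ℝ)) (f := atBot (α := ℝ))).sub (hS.pow 2) |>.sub
        (hT.pow 2)
      convert this using 2
      linear_combination ((2 - c)/8) ^ 2 * s3
    have hden : Tendsto (fun τ => 2 + (2 - c) * S τ) atBot (𝓝 (2 * (1 - ((2 - c)/4) ^ 2))) := by
      have := (hS.const_mul (2 - c)).const_add 2
      convert this using 2
      ring
    have hdenp : (0:ℝ) < 1 - ((2 - c)/4) ^ 2 := by nlinarith
    have hk : Tendsto (fun τ => 3/4 * (a τ - b τ) ^ 2) atBot (𝓝 (c * (2 - c)/16)) := by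
      have h1 := ((hS'.add ((hST.const_mul c).mul hS)).neg).div hden (by positivity)
      have h2 : -(0 + c * (1 - ((2 - c)/4) ^ 2) * -((2 - c)/8)) / (2 * (1 - ((2 - c)/4) ^ 2))
          = c * (2 - c)/16 := by
        rw [div_eq_iff (by positivity)]; ring
      rw [h2] at h1
      refine h1.congr (fun τ => ?_)
      have h3 : 2 + (2 - c) * S τ ≠ 0 := by
        have := H.S_gt τ
        have : 0 < 2 + (2 - c) * S τ := by nlinarith
        exact this.ne'
      simp only [Pi.div_apply]
      rw [div_eq_iff h3]
      linear_combination (c * S τ) * H.con τ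
    refine ⟨?_, hS, hT, ⟨√(c * (2 - c)/12), Real.sqrt_pos.2 (by positivity), ?_⟩, hb⟩
    · have := hST.sub hk
      rw [show 1 - ((2 - c)/4) ^ 2 - c * (2 - c)/16 = 1 - (2 - c)/8 by ring] at this
      refine this.congr (fun τ => ?_)
      linear_combination - H.con τ
    · have h1 := ((hk.const_mul (4/3)).add (H.p_tendsto.const_mul 2)).sub (hb.pow 2)
      rw [show 4/3 * (c * (2 - c)/16) + 2 * 0 - 0 ^ 2 = c * (2 - c)/12 by ring] at h1
      refine h1.sqrt.congr (fun τ => ?_)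
      rw [show 4/3 * (3/4 * (a τ - b τ) ^ 2) + 2 * (a τ * b τ) - b τ ^ 2 = a τ ^ 2 by ring]
      exact Real.sqrt_sq (H.ha τ).le

/-- Case B with `a, b → 0`: convergence to `F`. -/
lemma toF (H : Sys c O S T a b) {I : ℝ → ℝ}
    (hI : ∀ τ, HasDerivAt I (3/2 * (a τ - b τ) ^ 2 + c * O τ) τ)
    (hl : Tendsto I atBot atBot) {ω : ℝ} (hω : 0 < ω) (hO : ∀ τ, ω ≤ O τ)
    (ha : Tendsto a atBot (𝓝 0)) (hb : Tendsto b atBot (𝓝 0)) :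
    Tendsto O atBot (𝓝 1) ∧ Tendsto S atBot (𝓝 0) ∧ Tendsto T atBot (𝓝 0) := by
  have hc := H.c0
  have hB := H.caseB_basic hI hl
  have hE : Tendsto (fun τ => Real.exp (I τ)) atBot (𝓝 0) := Real.tendsto_exp_atBot.comp hl
  have hK : Tendsto (fun τ => 3/2 * (a τ - b τ) ^ 2) atBot (𝓝 0) := by
    have := ((ha.sub hb).pow 2).const_mul (3/2)
    simpa using this
  have hS : Tendsto S atBot (𝓝 0) := by
    rw [Metric.tendsto_nhds]
    intro ε hε
    have hev : ∀ᶠ τ in atBot, 3/2 * (a τ - b τ) ^ 2 < ε/2 * (c * ω) :=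
      hK.eventually (gt_mem_nhds (by positivity))
    obtain ⟨T0, hT0⟩ := eventually_atBot.1 hev
    have hmono : MonotoneOn (fun τ => (S τ + ε/2) * Real.exp (I τ)) (Iic T0) := by
      refine mono_of_deriv (fun τ _ => ((H.dS τ).add_const (ε/2)).mul (hI τ).exp) ?_
      intro τ hτ
      have h1 := hT0 τ hτ
      have h2 : ε/2 * (c * ω) ≤ ε/2 * (c * O τ) := by gcongr; exact hO τ
      have h3 : 0 ≤ 3/2 * (a τ - b τ) ^ 2 * (ε/2) := by positivity
      have h4 : 0 ≤ (ε/2 * (3/2 * (a τ - b τ) ^ 2 + c * O τ) - 3/2 * (a τ - b τ) ^ 2)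
        * Real.exp (I τ) := mul_nonneg (by linarith) (Real.exp_pos _).le
      linarith
    have hlim : Tendsto (fun τ => (S τ + ε/2) * Real.exp (I τ)) atBot (𝓝 0) :=
      bd_mul_tendsto (H.bdS.add (Bd.const (ε/2))) hE
    filter_upwards [eventually_le_atBot T0] with τ hτ
    have h1 := mono_ge_lim hmono hlim τ hτ
    have h2 := nonneg_of_mul_nonneg_left h1 (Real.exp_pos _)
    have h3 := (hB τ).1
    rw [Real.dist_eq, sub_zero, abs_lt]
    constructor <;> linarith
  have hO1 : Tendsto O atBot (𝓝 1) := by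
    have h1 : Tendsto (fun τ => 1 + 2 * S τ) atBot (𝓝 1) := by
      have := (hS.const_mul 2).const_add 1
      simpa using this
    exact tendsto_of_tendsto_of_tendsto_of_le_of_le h1 tendsto_const_nhds
      (fun τ => by have := (hB τ).2.2.1; simp only; linarith) (fun τ => H.O_le τ)
  refine ⟨hO1, hS, ?_⟩
  apply tendsto_zero_of_sq
  have h1 : Tendsto (fun τ => 1 - O τ) atBot (𝓝 0) := by
    have := hO1.const_sub 1
    simpa using this
  refine squeeze_zero (fun τ => sq_nonneg _) (fun τ => ?_) h1
  have := H.con τ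
  have := sq_nonneg (S τ)
  have := sq_nonneg (a τ - b τ)
  linarith

end Sys

namespace Sys

variable {c : ℝ} {O S T a b : ℝ → ℝ}

lemma main (H : Sys c O S T a b)
    (hF : ¬ (Tendsto O atBot (𝓝 1) ∧ Tendsto S atBot (𝓝 0) ∧ Tendsto T atBot (𝓝 0) ∧
      Tendsto a atBot (𝓝 0) ∧ Tendsto b atBot (𝓝 0)))
    (hP2 : ¬ (Tendsto O atBot (𝓝 (1 - (2 - c)/8)) ∧ Tendsto S atBot (𝓝 (-((2 - c)/8))) ∧
        Tendsto T atBot (𝓝 (-(√3 * (2 - c)/8))) ∧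
        (∃ l : ℝ, 0 < l ∧ Tendsto a atBot (𝓝 l)) ∧ Tendsto b atBot (𝓝 0)))
    (hP3 : ¬ (Tendsto O atBot (𝓝 (1 - (2 - c)/8)) ∧ Tendsto S atBot (𝓝 (-((2 - c)/8))) ∧
        Tendsto (fun τ => - T τ) atBot (𝓝 (-(√3 * (2 - c)/8))) ∧
        (∃ l : ℝ, 0 < l ∧ Tendsto b atBot (𝓝 l)) ∧ Tendsto a atBot (𝓝 0))) :
    ∃ s t : ℝ, s ^ 2 + t ^ 2 = 1 ∧ 1/2 < s ∧
      Tendsto O atBot (𝓝 0) ∧ Tendsto S atBot (𝓝 s) ∧ Tendsto T atBot (𝓝 t) ∧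
      Tendsto a atBot (𝓝 0) ∧ Tendsto b atBot (𝓝 0) := by
  obtain ⟨I, hI⟩ := H.exists_I
  have hmono : AntitoneOn (fun τ => - I τ) (Iic 0) :=
    anti_of_deriv (fun τ _ => (hI τ).neg) (fun τ _ => by linarith [(H.w_bounds τ).1])
  rcases anti_dichotomy hmono with h | ⟨l, hl⟩
  · exfalso
    have hl : Tendsto I atBot atBot := by
      have := tendsto_neg_atTop_atBot.comp h
      simpa [Function.comp_def] using this
    obtain ⟨δ, hδ, hδ1⟩ := H.caseB_h hI hl
    have hB := H.caseB_basic hI hl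
    have hω : 0 < δ ^ 2 := by positivity
    have hO : ∀ τ, δ ^ 2 ≤ O τ := fun τ => by
      have h1 := (hB τ).2.2.2
      have h2 := hδ1 τ
      nlinarith
    have hS0 : ∀ τ, S τ ≤ 0 := fun τ => (hB τ).1
    rcases H.typeII hω hO hS0 with ha | hc
    · rcases H.swap.typeII hω hO hS0 with hb | hc
      · obtain ⟨h1, h2, h3⟩ := H.toF hI hl hω hO ha hb
        exact hF ⟨h1, h2, h3, ha, hb⟩
      · exact hP3 hc
    · exact hP2 hc
  · have hl' : Tendsto I atBot (𝓝 (-l)) := by simpa using hl.neg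
    exact H.caseA hI hl'

end Sys

/-- `y = 4/3 Σ₋² + (N₂ - N₃)²` does not vanish for a solution which is not of Taub type. -/
lemma y_pos {y r : ℝ → ℝ} (hd : ∀ τ, HasDerivAt y (r τ) τ) (h1 : ∀ τ, -4 * y τ ≤ r τ)
    (h2 : ∀ τ, r τ ≤ 8 * y τ) (h0 : ∀ τ, 0 ≤ y τ) (hne : ∃ τ, y τ ≠ 0) : ∀ τ, 0 < y τ := by
  intro τ0
  rcases (h0 τ0).eq_or_lt with h | h
  swap
  · exact h
  exfalso
  obtain ⟨τ1, hτ1⟩ := hne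
  apply hτ1
  have m1 : ∀ T, MonotoneOn (fun τ => y τ * Real.exp (4 * τ)) (Iic T) := fun T => by
    refine mono_of_deriv (fun τ _ => (hd τ).mul ((hasDerivAt_id τ).const_mul 4).exp) ?_
    intro τ _
    have h3 : 0 ≤ (r τ + 4 * y τ) * Real.exp (4 * τ) :=
      mul_nonneg (by linarith [h1 τ]) (Real.exp_pos _).le
    simp only [id]
    linarith
  have m2 : ∀ T, AntitoneOn (fun τ => y τ * Real.exp (-8 * τ)) (Iic T) := fun T => by
    refine anti_of_deriv (fun τ _ => (hd τ).mul ((hasDerivAt_id τ).const_mul (-8)).exp) ?_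
    intro τ _
    have h3 : 0 ≤ (8 * y τ - r τ) * Real.exp (-8 * τ) :=
      mul_nonneg (by linarith [h2 τ]) (Real.exp_pos _).le
    simp only [id]
    linarith
  apply le_antisymm _ (h0 τ1)
  by_contra hpos
  push Not at hpos
  rcases le_total τ0 τ1 with hle | hle
  · have := m2 τ1 (mem_Iic.2 hle) (mem_Iic.2 le_rfl) hle
    simp only [← h, zero_mul] at this
    have := mul_pos hpos (Real.exp_pos (-8 * τ1))
    linarith
  · have := m1 τ0 (mem_Iic.2 hle) (mem_Iic.2 le_rfl) hle
    simp only [← h, zero_mul] at this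
    have := mul_pos hpos (Real.exp_pos (4 * τ1))
    linarith


/-- a generic Bianchi VII₀ solution (with `N₁ = 0`, `N₂, N₃ > 0`,
`2/3 < γ < 2`, not of Taub type, not converging to `F`, `P₂⁺(II)` or `P₃⁺(II)`)
converges as `τ → -∞` to a point of the Kasner circle lying in `K₁`. -/
theorem bianchiVII0_generic_convergence
    (γ : ℝ) (hγ1 : 2/3 < γ) (hγ2 : γ < 2)
    (O Sp Sm n1 n2 n3 : ℝ → ℝ)
    (hsol : SolOn γ Set.univ O Sp Sm n1 n2 n3)
    (hn1 : ∀ τ : ℝ, n1 τ = 0) (hn2 : ∀ τ : ℝ, 0 < n2 τ) (hn3 : ∀ τ : ℝ, 0 < n3 τ)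
    (htaub : ¬ TaubType Set.univ Sp Sm n1 n2 n3)
    (hF : ¬ TendstoF O Sp Sm n1 n2 n3)
    (hP2 : ¬ TendstoP2 γ O Sp Sm n1 n2 n3)
    (hP3 : ¬ TendstoP3 γ O Sp Sm n1 n2 n3) :
    ∃ a b : ℝ, a^2 + b^2 = 1 ∧ 1/2 < a ∧
      Tendsto O atBot (𝓝 0) ∧ Tendsto Sp atBot (𝓝 a) ∧ Tendsto Sm atBot (𝓝 b) ∧
      Tendsto n2 atBot (𝓝 0) ∧ Tendsto n3 atBot (𝓝 0) := by
  set c : ℝ := (6 - 3 * γ) / 2 with hc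
  have hc0 : 0 < c := by rw [hc]; linarith
  have hc2 : c < 2 := by rw [hc]; linarith
  have con : ∀ τ, O τ + Sp τ ^ 2 + Sm τ ^ 2 + 3/4 * (n2 τ - n3 τ) ^ 2 = 1 := by
    intro τ
    have h := hsol.hcon τ (mem_univ τ)
    unfold Constraint at h
    rw [hn1 τ] at h
    linear_combination h
  have hOnn : ∀ τ, 0 ≤ O τ := fun τ => hsol.hOnn τ (mem_univ τ)
  have hq : ∀ τ, qf γ (O τ) (Sp τ) (Sm τ) = 2 - (3/2 * (n2 τ - n3 τ) ^ 2 + c * O τ) := by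
    intro τ
    unfold qf
    rw [hc]
    linear_combination 2 * con τ
  have da : ∀ τ, HasDerivAt n2 ((2 - (3/2 * (n2 τ - n3 τ) ^ 2 + c * O τ) + 2 * Sp τ
      + 2 * √3 * Sm τ) * n2 τ) τ := by
    intro τ
    have h := hsol.hn2 τ (mem_univ τ)
    rwa [hq τ] at h
  have db : ∀ τ, HasDerivAt n3 ((2 - (3/2 * (n2 τ - n3 τ) ^ 2 + c * O τ) + 2 * Sp τ
      - 2 * √3 * Sm τ) * n3 τ) τ := by
    intro τ
    have h := hsol.hn3 τ (mem_univ τ)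
    rwa [hq τ] at h
  have dS : ∀ τ, HasDerivAt Sp (-(3/2 * (n2 τ - n3 τ) ^ 2 + c * O τ) * Sp τ
      - 3/2 * (n2 τ - n3 τ) ^ 2) τ := by
    intro τ
    refine (hsol.hSp τ (mem_univ τ)).congr_deriv ?_
    rw [hq τ, hn1 τ]
    unfold SPf
    ring
  have dT : ∀ τ, HasDerivAt Sm (-(3/2 * (n2 τ - n3 τ) ^ 2 + c * O τ) * Sm τ
      - 3/2 * √3 * (n2 τ ^ 2 - n3 τ ^ 2)) τ := by
    intro τ
    refine (hsol.hSm τ (mem_univ τ)).congr_deriv ?_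
    rw [hq τ, hn1 τ]
    unfold SMf
    ring
  have dO : ∀ τ, HasDerivAt O ((2 * c - 2 * (3/2 * (n2 τ - n3 τ) ^ 2 + c * O τ)) * O τ) τ := by
    intro τ
    refine (hsol.hO τ (mem_univ τ)).congr_deriv ?_
    rw [hq τ, hc]
    ring
  have dy : ∀ τ, HasDerivAt (fun τ => 4/3 * Sm τ ^ 2 + (n2 τ - n3 τ) ^ 2)
      (-(8/3) * (3/2 * (n2 τ - n3 τ) ^ 2 + c * O τ) * Sm τ ^ 2
        + (4 - 2 * (3/2 * (n2 τ - n3 τ) ^ 2 + c * O τ) + 4 * Sp τ) * (n2 τ - n3 τ) ^ 2) τ := by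
    intro τ
    refine ((((dT τ).pow 2).const_mul (4/3)).add (((da τ).sub (db τ)).pow 2)).congr_deriv ?_
    simp only [Pi.sub_apply, Nat.cast_ofNat, Nat.add_one_sub_one, pow_one]; ring
  have hw : ∀ τ, 0 ≤ 3/2 * (n2 τ - n3 τ) ^ 2 + c * O τ ∧
      3/2 * (n2 τ - n3 τ) ^ 2 + c * O τ ≤ 2 := by
    intro τ
    have h1 := con τ
    have h2 := hOnn τ
    constructor
    · positivity
    · nlinarith [sq_nonneg (Sp τ), sq_nonneg (Sm τ)]
  have hSabs : ∀ τ, -1 ≤ Sp τ ∧ Sp τ ≤ 1 := by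
    intro τ
    have h1 := con τ
    have h2 := hOnn τ
    constructor <;> nlinarith [sq_nonneg (Sm τ), sq_nonneg (n2 τ - n3 τ)]
  have hy : ∀ τ, 0 < 4/3 * Sm τ ^ 2 + (n2 τ - n3 τ) ^ 2 := by
    refine y_pos dy (fun τ => ?_) (fun τ => ?_) (fun τ => by positivity) ?_
    · obtain ⟨h1, h2⟩ := hw τ
      obtain ⟨h3, h4⟩ := hSabs τ
      set w := 3/2 * (n2 τ - n3 τ) ^ 2 + c * O τ
      have e1 : 0 ≤ (2 - w) * Sm τ ^ 2 := mul_nonneg (by linarith) (sq_nonneg _)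
      have e2 : 0 ≤ (8 - 2 * w + 4 * Sp τ) * (n2 τ - n3 τ) ^ 2 :=
        mul_nonneg (by linarith) (sq_nonneg _)
      linarith
    · obtain ⟨h1, h2⟩ := hw τ
      obtain ⟨h3, h4⟩ := hSabs τ
      set w := 3/2 * (n2 τ - n3 τ) ^ 2 + c * O τ
      have e1 : 0 ≤ w * Sm τ ^ 2 := mul_nonneg (by linarith) (sq_nonneg _)
      have e2 : 0 ≤ (4 + 2 * w - 4 * Sp τ) * (n2 τ - n3 τ) ^ 2 :=
        mul_nonneg (by linarith) (sq_nonneg _)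
      have e3 := sq_nonneg (Sm τ)
      linarith
    · by_contra hall
      push Not at hall
      apply htaub
      left
      intro τ _
      have h1 := hall τ
      have h2 : Sm τ ^ 2 = 0 := by nlinarith [sq_nonneg (Sm τ), sq_nonneg (n2 τ - n3 τ)]
      have h3 : (n2 τ - n3 τ) ^ 2 = 0 := by nlinarith [sq_nonneg (Sm τ), sq_nonneg (n2 τ - n3 τ)]
      exact ⟨pow_eq_zero_iff (two_ne_zero) |>.1 h2,
        sub_eq_zero.1 (pow_eq_zero_iff (two_ne_zero) |>.1 h3)⟩
  have H : Sys c O Sp Sm n2 n3 :=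
    { c0 := hc0, c2 := hc2, ha := hn2, hb := hn3, hO := hOnn, con := con, da := da, db := db,
      dS := dS, dT := dT, dO := dO, hy := hy }
  have hn1t : Tendsto n1 atBot (𝓝 0) := by
    rw [show n1 = fun _ => 0 from funext hn1]
    exact tendsto_const_nhds
  have hcc : (2 - c) / 8 = (3 * γ - 2) / 16 := by rw [hc]; ring
  have hcc' : √3 * (2 - c) / 8 = √3 * (3 * γ - 2) / 16 := by rw [hc]; ring
  refine H.main ?_ ?_ ?_
  · rintro ⟨h1, h2, h3, h4, h5⟩
    exact hF ⟨h1, h2, h3, hn1t, h4, h5⟩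
  · rintro ⟨h1, h2, h3, h4, h5⟩
    rw [hcc] at h1 h2
    rw [hcc'] at h3
    exact hP2 ⟨h1, h2, h3, hn1t, h4, h5⟩
  · rintro ⟨h1, h2, h3, h4, h5⟩
    rw [hcc] at h1 h2
    rw [hcc'] at h3
    have h6 := h3.neg
    simp only [neg_neg] at h6
    exact hP3 ⟨h1, h2, h6, hn1t, h5, h4⟩

end WainwrightHsu
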